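/- arXiv:2303.07813 — 2 statements merged into one kernel-verified Lean document; each statement's English description precedes it below -/
import Mathlib

section
/- Let K be a positive real number, N ∈ ℕ, 0 < s < 1 with 2(1−s)N/(s+1) ≤ 1/2, and let m ∈ ℕ be odd with ⌊K⌋ ≤ m. Then for every X ∈ SO(2N+1) the quantity −Λ_X'(s)/Λ_X(s) is positive, and |(1−s)^K ∫_{SO(2N+1)} (−Λ_X'(s)/Λ_X(s))^K dHaar(X) − Σ_{n=0}^{m} binom(K,n) · h(n,s,N)| ≤ C_{K,m} · h(m+1, s, N), where C_{K,m} = |binom(K,m+1)| · 2^{m+1−K}. -/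
open MeasureTheory Real Filter Matrix

noncomputable section

instance matrixMeasurableSpace {m n α : Type*} [MeasurableSpace α] :
    MeasurableSpace (Matrix m n α) :=
  (inferInstance : MeasurableSpace (m → n → α))

/-- The special orthogonal group `SO(n)`, realised as the subgroup of the orthogonal group
`O(n)` consisting of matrices of determinant one. -/
def SOsub (n : ℕ) : Subgroup (Matrix.orthogonalGroup (Fin n) ℝ) where
  carrier := {X | (X : Matrix (Fin n) (Fin n) ℝ).det = 1}
  one_mem' := by simp
  mul_mem' := by
    intro a b ha hb
    simp only [Set.mem_setOf_eq] at *
    simp [Matrix.det_mul, ha, hb]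
  inv_mem' := by
    intro a ha
    simp only [Set.mem_setOf_eq] at *
    have h : ((a⁻¹ * a : Matrix.orthogonalGroup (Fin n) ℝ) : Matrix (Fin n) (Fin n) ℝ) = 1 := by
      simp
    have := congrArg Matrix.det h
    simp only [MulMemClass.coe_mul, Matrix.det_mul, ha, mul_one, Matrix.det_one] at this
    exact this

/-- The group `SO(2N+1)`. -/
abbrev SOodd (N : ℕ) := ↥(SOsub (2 * N + 1))

/-- The matrix underlying an element of `SO(2N+1)`. -/
def mat {N : ℕ} (X : SOodd N) : Matrix (Fin (2 * N + 1)) (Fin (2 * N + 1)) ℝ :=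
  ((X : Matrix.orthogonalGroup (Fin (2 * N + 1)) ℝ) : Matrix (Fin (2 * N + 1)) (Fin (2 * N + 1)) ℝ)

/-- The characteristic polynomial `Λ_X(s) = det(I - s Xᵀ)` of `X ∈ SO(2N+1)`. -/
def charPoly {N : ℕ} (X : SOodd N) (s : ℝ) : ℝ :=
  (1 - s • (mat X)ᵀ).det

/-- The generalized binomial coefficient `binom(α, n) = (1/n!) ∏_{j=0}^{n-1} (α - j)`. -/
def genBinom (α : ℝ) (n : ℕ) : ℝ :=
  (1 / n.factorial) * ∏ j ∈ Finset.range n, (α - j)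

/-- The joint eigenangle density of `SO(2N+1)` on `[0,π]^N`. -/
def densitySO (N : ℕ) (θ : Fin N → ℝ) : ℝ :=
  (2 ^ (N ^ 2) / (π ^ N * N.factorial)) *
    (∏ j : Fin N, ∏ k ∈ Finset.Ioi j, (Real.cos (θ k) - Real.cos (θ j)) ^ 2) *
    ∏ m : Fin N, Real.sin (θ m / 2) ^ 2

/-- `h(n, s, N)`: the `n`-th moment of the eigenvalue sum against the eigenangle density. -/
def hFun (n : ℕ) (s : ℝ) (N : ℕ) : ℝ :=
  ∫ θ in Set.univ.pi fun _ : Fin N => Set.Icc (0 : ℝ) π,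
    ((s - 1) * ∑ j, (2 * s - 2 * Real.cos (θ j)) / (1 + s ^ 2 - 2 * s * Real.cos (θ j))) ^ n *
      densitySO N θ

/-- `g(l, s, N)`: the integral of `∏_j ((1-s)² + 4s sin²(θ_j/2))^{-l_j}` against the
eigenangle density. -/
def gFun (N : ℕ) (l : Fin N → ℕ) (s : ℝ) : ℝ :=
  ∫ θ in Set.univ.pi fun _ : Fin N => Set.Icc (0 : ℝ) π,
    (∏ j, ((1 - s) ^ 2 + 4 * s * Real.sin (θ j / 2) ^ 2) ^ (-(l j : ℤ))) * densitySO N θ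

theorem mul_genBinom_sub_one (K : ℝ) (n : ℕ) :
    K * genBinom (K - 1) n = (n + 1) * genBinom K (n + 1) := by
  have h : ∏ j ∈ Finset.range n, (K - 1 - (j : ℝ)) =
      ∏ j ∈ Finset.range n, (K - ((j + 1 : ℕ) : ℝ)) := by
    refine Finset.prod_congr rfl fun j _ => ?_
    push_cast; ring
  simp only [genBinom, Finset.prod_range_succ', h, Nat.factorial_succ]
  have h1 : (n.factorial : ℝ) ≠ 0 := by positivity
  have h2 : ((n : ℝ) + 1) ≠ 0 := by positivity
  push_cast
  field_simp
  ring

theorem abs_one_add_rpow_sub_sum_le (j : ℕ) : ∀ (K : ℝ), K ≤ j → ∀ y : ℝ, -(1 / 2) ≤ y →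
    |(1 + y) ^ K - ∑ n ∈ Finset.range j, genBinom K n * y ^ n| ≤
      |genBinom K j| * 2 ^ ((j : ℝ) - K) * |y| ^ j := by
  induction j with
  | zero =>
    intro K hK y hy
    simp only [Nat.cast_zero] at hK
    have h2 : (2 : ℝ) ^ (0 - K) = (1 / 2 : ℝ) ^ K := by
      rw [zero_sub, Real.rpow_neg (by norm_num), one_div, Real.inv_rpow (by norm_num)]
    simp only [Finset.range_zero, Finset.sum_empty, sub_zero, Nat.cast_zero, genBinom,
      Nat.factorial_zero, Nat.cast_one, div_one, Finset.prod_empty, mul_one, abs_one, one_mul,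
      pow_zero]
    rw [h2, abs_of_nonneg (Real.rpow_nonneg (by linarith) _)]
    exact Real.rpow_le_rpow_of_nonpos (by norm_num) (by linarith) hK
  | succ j ih =>
    intro K hK y hy
    push_cast at hK
    set C : ℝ := |genBinom K (j + 1)| * 2 ^ (((j + 1 : ℕ) : ℝ) - K) * |y| ^ (j + 1) with hC
    have hpos : ∀ u ∈ Set.Icc (0 : ℝ) 1, -(1 / 2) ≤ y * u := by
      intro u hu
      nlinarith [hu.1, hu.2, mul_nonneg hu.1 (by linarith : 0 ≤ y + 1 / 2)]
    have hder : ∀ u ∈ Set.Icc (0 : ℝ) 1, HasDerivAt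
        (fun u : ℝ => (1 + y * u) ^ K - ∑ n ∈ Finset.range (j + 1), genBinom K n * (y * u) ^ n)
        (y * (K * ((1 + y * u) ^ (K - 1) -
          ∑ n ∈ Finset.range j, genBinom (K - 1) n * (y * u) ^ n))) u := by
      intro u hu
      have h0 : HasDerivAt (fun u : ℝ => y * u) y u := by
        simpa using (hasDerivAt_id u).const_mul y
      have h1 : HasDerivAt (fun u : ℝ => (1 + y * u) ^ K) (y * K * (1 + y * u) ^ (K - 1)) u :=
        (h0.const_add 1).rpow_const (Or.inl (by linarith [hpos u hu]))
      have h2 : HasDerivAt (fun u : ℝ => ∑ n ∈ Finset.range (j + 1), genBinom K n * (y * u) ^ n)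
          (∑ n ∈ Finset.range (j + 1), genBinom K n * (n * (y * u) ^ (n - 1) * y)) u :=
        HasDerivAt.fun_sum fun n _ => (h0.pow n).const_mul _
      refine (h1.sub h2).congr_deriv ?_
      rw [Finset.sum_range_succ', mul_sub, mul_sub, Finset.mul_sum, Finset.mul_sum]
      simp only [Nat.cast_zero, zero_mul, mul_zero, add_zero, Nat.add_sub_cancel]
      congr 1
      · ring
      · refine Finset.sum_congr rfl fun n _ => ?_
        have := mul_genBinom_sub_one K n
        push_cast
        linear_combination (-(y * (y * u) ^ n)) * this
    have hbd : ∀ u ∈ Set.Ico (0 : ℝ) 1, ‖y * (K * ((1 + y * u) ^ (K - 1) -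
          ∑ n ∈ Finset.range j, genBinom (K - 1) n * (y * u) ^ n))‖ ≤ C * ((j + 1) * u ^ j) := by
      intro u hu
      have h1 := ih (K - 1) (by linarith) (y * u) (hpos u ⟨hu.1, hu.2.le⟩)
      rw [Real.norm_eq_abs, abs_mul, abs_mul]
      calc |y| * (|K| * _) ≤ |y| * (|K| * (|genBinom (K - 1) j| * 2 ^ ((j : ℝ) - (K - 1)) *
            |y * u| ^ j)) := by gcongr
        _ = |K * genBinom (K - 1) j| * 2 ^ ((j : ℝ) - (K - 1)) * |y| ^ (j + 1) * u ^ j := by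
            rw [abs_mul, abs_mul, abs_of_nonneg hu.1]; ring
        _ = C * ((j + 1) * u ^ j) := by
            rw [mul_genBinom_sub_one, abs_mul, abs_of_nonneg (by positivity : (0 : ℝ) ≤ j + 1), hC]
            rw [show (j : ℝ) - (K - 1) = ((j + 1 : ℕ) : ℝ) - K by push_cast; ring]
            ring
    have := image_norm_le_of_norm_deriv_right_le_deriv_boundary
      (f := fun u : ℝ => (1 + y * u) ^ K - ∑ n ∈ Finset.range (j + 1), genBinom K n * (y * u) ^ n)
      (B := fun u => C * u ^ (j + 1)) (B' := fun u => C * ((j + 1) * u ^ j)) (a := 0) (b := 1)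
      (fun u hu => (hder u hu).continuousAt.continuousWithinAt)
      (fun u hu => (hder u ⟨hu.1, hu.2.le⟩).hasDerivWithinAt)
      (by simp [Finset.sum_range_succ', genBinom]) 
      (fun u => by
        have := (hasDerivAt_pow (j + 1) u).const_mul C
        simpa using this) hbd (x := 1) (by simp)
    simpa [hC] using this

/-- The monic polynomials `W_n` with `W_n (2 cos θ) = sin ((n + 1/2) θ) / sin (θ / 2)`. -/
def chebW : ℕ → Polynomial ℝ
  | 0 => 1
  | 1 => Polynomial.X + 1
  | n + 2 => Polynomial.X * chebW (n + 1) - chebW n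

theorem chebW_monic_natDegree (n : ℕ) : (chebW n).Monic ∧ (chebW n).natDegree = n := by
  induction n using Nat.twoStepInduction with
  | zero => simp [chebW]
  | one =>
    have h : (Polynomial.X + 1 : Polynomial ℝ) = Polynomial.X + Polynomial.C 1 := by simp
    rw [chebW, h]
    exact ⟨Polynomial.monic_X_add_C _, Polynomial.natDegree_X_add_C _⟩
  | more n ih1 ih2 =>
    rw [chebW]
    have hX : (Polynomial.X * chebW (n + 1)).Monic := Polynomial.monic_X.mul ih2.1
    have hXd : (Polynomial.X * chebW (n + 1)).natDegree = n + 2 := by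
      rw [Polynomial.natDegree_X_mul ih2.1.ne_zero, ih2.2]
    have hlt : (chebW n).degree < (Polynomial.X * chebW (n + 1)).degree := by
      rw [Polynomial.degree_eq_natDegree ih1.1.ne_zero, Polynomial.degree_eq_natDegree hX.ne_zero,
        ih1.2, hXd]
      exact_mod_cast (by omega)
    refine ⟨hX.sub_of_left hlt, ?_⟩
    rw [Polynomial.natDegree_sub_eq_left_of_natDegree_lt (Polynomial.natDegree_lt_natDegree
      ih1.1.ne_zero hlt), hXd]

theorem one_sub_mul_pow_mul_eval_chebW {s : ℝ} (hs : s ≠ 0) (n : ℕ) :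
    (1 - s) * s ^ n * (chebW n).eval (s + s⁻¹) = 1 - s ^ (2 * n + 1) := by
  induction n using Nat.twoStepInduction with
  | zero => simp [chebW]
  | one =>
    simp only [chebW, Polynomial.eval_add, Polynomial.eval_X, Polynomial.eval_one]
    field_simp
    ring
  | more n ih1 ih2 =>
    simp only [chebW, Polynomial.eval_sub, Polynomial.eval_mul, Polynomial.eval_X]
    have h1 : (1 - s) * s ^ (n + 2) * ((s + s⁻¹) * (chebW (n + 1)).eval (s + s⁻¹) -
        (chebW n).eval (s + s⁻¹)) =
        (s * (s + s⁻¹)) * ((1 - s) * s ^ (n + 1) * (chebW (n + 1)).eval (s + s⁻¹)) -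
        s ^ 2 * ((1 - s) * s ^ n * (chebW n).eval (s + s⁻¹)) := by ring
    rw [h1, ih1, ih2, mul_add, mul_inv_cancel₀ hs]
    ring

theorem sin_half_mul_eval_chebW (θ : ℝ) (n : ℕ) :
    sin (θ / 2) * (chebW n).eval (2 * cos θ) = sin ((n + 1 / 2) * θ) := by
  induction n using Nat.twoStepInduction with
  | zero => simp [chebW]; ring_nf
  | one =>
    have h1 : ((1 : ℕ) + 1 / 2 : ℝ) * θ = θ + θ / 2 := by push_cast; ring
    have h2 : cos θ = 1 - 2 * sin (θ / 2) ^ 2 := by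
      rw [← cos_sq_add_sin_sq (θ / 2)]; nth_rw 1 [show θ = 2 * (θ / 2) by ring]
      rw [cos_two_mul']; ring
    have h3 : sin θ = 2 * sin (θ / 2) * cos (θ / 2) := by
      nth_rw 1 [show θ = 2 * (θ / 2) by ring]; rw [sin_two_mul]
    simp only [chebW, Polynomial.eval_add, Polynomial.eval_X, Polynomial.eval_one]
    rw [h1, sin_add, h3, h2]
    linear_combination (-2 * sin (θ / 2)) * cos_sq_add_sin_sq (θ / 2)
  | more n ih1 ih2 =>
    simp only [chebW, Polynomial.eval_sub, Polynomial.eval_mul, Polynomial.eval_X]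
    have h1 : sin (θ / 2) * (2 * cos θ * (chebW (n + 1)).eval (2 * cos θ) -
        (chebW n).eval (2 * cos θ)) = 2 * cos θ * (sin (θ / 2) * (chebW (n + 1)).eval (2 * cos θ))
        - sin (θ / 2) * (chebW n).eval (2 * cos θ) := by ring
    rw [h1, ih1, ih2]
    have h2 : ((n + 2 : ℕ) + 1 / 2 : ℝ) * θ = ((n + 1 : ℕ) + 1 / 2 : ℝ) * θ + θ := by
      push_cast; ring
    have h3 : ((n : ℕ) + 1 / 2 : ℝ) * θ = ((n + 1 : ℕ) + 1 / 2 : ℝ) * θ - θ := by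
      push_cast; ring
    rw [h2, h3, sin_add, sin_sub]
    ring

theorem trace_pow_eq_sum_eigenvalues_pow {n : Type*} [Fintype n] [DecidableEq n]
    {A : Matrix n n ℝ} (hA : A.IsHermitian) (k : ℕ) :
    (A ^ k).trace = ∑ i, hA.eigenvalues i ^ k := by
  conv_lhs => rw [hA.spectral_theorem, ← map_pow, Unitary.conjStarAlgAut_apply, mul_assoc,
    trace_mul_comm, mul_assoc]
  simp [Matrix.diagonal_pow, Matrix.trace_diagonal]

section Spectral

variable {N : ℕ} {X : Matrix (Fin (2 * N + 1)) (Fin (2 * N + 1)) ℝ}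

/-- The polynomial `r` of degree `N` with `det (1 - s Xᵀ) = (1 - s) s^N r(s + 1/s)`. -/
def halfCharpoly (X : Matrix (Fin (2 * N + 1)) (Fin (2 * N + 1)) ℝ) : Polynomial ℝ :=
  ∑ i ∈ Finset.range (N + 1), Polynomial.C (Xᵀ.charpolyRev.coeff i) * chebW (N - i)

theorem eval_charpolyRev_eq_det {n : Type*} [Fintype n] [DecidableEq n] (A : Matrix n n ℝ)
    (s : ℝ) : A.charpolyRev.eval s = (1 - s • A).det := by
  rw [charpolyRev, ← Polynomial.coe_evalRingHom, RingHom.map_det]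
  congr 1
  ext i j
  by_cases h : i = j <;> simp [h] <;> ring

theorem charpolyRev_coeff_reflect (h : X * Xᵀ = 1) (hd : X.det = 1) {i : ℕ}
    (hi : i ≤ 2 * N + 1) :
    Xᵀ.charpolyRev.coeff (2 * N + 1 - i) = -Xᵀ.charpolyRev.coeff i := by
  have hinv : (Xᵀ)⁻¹ = X := Matrix.inv_eq_left_inv h
  have h1 : Xᵀ.charpoly = -Xᵀ.charpolyRev := by
    have := Matrix.charpoly_inv Xᵀ (by rw [Matrix.isUnit_iff_isUnit_det]; simp [hd])
    rw [hinv, ← Matrix.charpoly_transpose] at this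
    rw [this]
    simp [hd, pow_succ, pow_mul]
  have h2 := Xᵀ.reverse_charpoly
  have h3 := congrArg (fun p => Polynomial.coeff p (2 * N + 1 - i)) h2
  simp only [Polynomial.coeff_reverse, Matrix.charpoly_natDegree_eq_dim, Fintype.card_fin] at h3
  rw [Polynomial.revAt_le (by omega), h1] at h3
  rw [← h3, show 2 * N + 1 - (2 * N + 1 - i) = i by omega, Polynomial.coeff_neg]

theorem det_one_sub_smul_transpose (h : X * Xᵀ = 1) (hd : X.det = 1) {s : ℝ} (hs : s ≠ 0) :
    (1 - s • Xᵀ).det = (1 - s) * s ^ N * (halfCharpoly X).eval (s + s⁻¹) := by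
  rw [← eval_charpolyRev_eq_det]
  have hdeg : Xᵀ.charpolyRev.natDegree < (N + 1) + (N + 1) := by
    rw [← Matrix.reverse_charpoly]
    refine (Polynomial.reverse_natDegree_le _).trans_lt ?_
    rw [Matrix.charpoly_natDegree_eq_dim, Fintype.card_fin]; omega
  rw [Polynomial.eval_eq_sum_range' hdeg, Finset.sum_range_add, halfCharpoly,
    Polynomial.eval_finsetSum, Finset.mul_sum,
    ← Finset.sum_range_reflect (fun x => Xᵀ.charpolyRev.coeff (N + 1 + x) * s ^ (N + 1 + x)),
    ← Finset.sum_add_distrib]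
  refine Finset.sum_congr rfl fun i hi => ?_
  have hi' : i ≤ N := Nat.lt_succ_iff.mp (Finset.mem_range.mp hi)
  rw [show N + 1 + (N + 1 - 1 - i) = 2 * N + 1 - i by omega,
    charpolyRev_coeff_reflect h hd (by omega), Polynomial.eval_mul, Polynomial.eval_C]
  have hW := one_sub_mul_pow_mul_eval_chebW hs (N - i)
  have h1 : s ^ N = s ^ i * s ^ (N - i) := by rw [← pow_add]; congr 1; omega
  have h2 : s ^ (2 * N + 1 - i) = s ^ i * s ^ (2 * (N - i) + 1) := by
    rw [← pow_add]; congr 1; omega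
  rw [h1, h2]
  linear_combination (-(Xᵀ.charpolyRev.coeff i * s ^ i)) * hW

theorem halfCharpoly_monic_natDegree :
    (halfCharpoly X).Monic ∧ (halfCharpoly X).natDegree = N := by
  have hle : (halfCharpoly X).natDegree ≤ N := by
    refine Polynomial.natDegree_sum_le_of_forall_le _ _ fun i _ => ?_
    refine (Polynomial.natDegree_C_mul_le _ _).trans ?_
    rw [(chebW_monic_natDegree _).2]; omega
  have hc : (halfCharpoly X).coeff N = 1 := by
    rw [halfCharpoly, Polynomial.finsetSum_coeff, Finset.sum_range_succ', Finset.sum_eq_zero]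
    · have h0 : Xᵀ.charpolyRev.coeff 0 = 1 := by
        rw [Polynomial.coeff_zero_eq_eval_zero, Matrix.eval_charpolyRev]
      have := (chebW_monic_natDegree N).1.coeff_natDegree
      rw [(chebW_monic_natDegree N).2] at this
      simp [h0, this]
    · intro i hi
      rw [Polynomial.coeff_C_mul, Polynomial.coeff_eq_zero_of_natDegree_lt (p := chebW _), mul_zero]
      rw [(chebW_monic_natDegree _).2]
      have := Finset.mem_range.mp hi
      omega
  have hm := Polynomial.monic_of_natDegree_le_of_coeff_eq_one N hle hc
  exact ⟨hm, le_antisymm hle (Polynomial.le_natDegree_of_ne_zero (by simp [hc]))⟩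

theorem charpoly_add_transpose (h : X * Xᵀ = 1) (hd : X.det = 1) :
    (X + Xᵀ).charpoly = (Polynomial.X - Polynomial.C 2) * halfCharpoly X ^ 2 := by
  refine Polynomial.eq_of_infinite_eval_eq _ _ ((Set.Ioi_infinite (2 : ℝ)).mono ?_)
  intro u hu
  have hu : 2 < u := hu
  set s : ℝ := (u + √(u ^ 2 - 4)) / 2 with hsdef
  have hsq : √(u ^ 2 - 4) ^ 2 = u ^ 2 - 4 := Real.sq_sqrt (by nlinarith)
  have hspos : 0 < s := by have := Real.sqrt_nonneg (u ^ 2 - 4); rw [hsdef]; linarith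
  have hquad : s ^ 2 + 1 = u * s := by rw [hsdef]; linear_combination hsq / 4
  have hus : s + s⁻¹ = u := by field_simp; linarith
  have hΛ := det_one_sub_smul_transpose h hd hspos.ne'
  rw [hus] at hΛ
  have hΛ' : (1 - s • X).det = (1 - s • Xᵀ).det := by
    rw [← Matrix.det_transpose]; simp
  have hprod : (1 - s • Xᵀ).det * (1 - s • X).det = s ^ (2 * N + 1) * (X + Xᵀ).charpoly.eval u := by
    have h' : Xᵀ * X = 1 := mul_eq_one_comm.mp h
    rw [← Matrix.det_mul, Matrix.eval_charpoly]
    have h2 := Matrix.det_smul (Matrix.scalar (Fin (2 * N + 1)) u - (X + Xᵀ)) s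
    rw [Fintype.card_fin] at h2
    rw [← h2]
    congr 1
    have h3 : Matrix.scalar (Fin (2 * N + 1)) u = u • (1 : Matrix _ _ ℝ) := by
      rw [Matrix.scalar_apply, Matrix.smul_one_eq_diagonal]
    rw [h3, smul_sub, smul_smul, mul_comm s u, ← hquad, add_smul, sub_mul, mul_sub, mul_sub]
    simp only [one_mul, mul_one, one_smul, smul_add, Matrix.smul_mul, Matrix.mul_smul, h',
      smul_smul, pow_two]
    abel
  have hmain : s ^ (2 * N + 1) * (X + Xᵀ).charpoly.eval u =
      s ^ (2 * N + 1) * ((u - 2) * (halfCharpoly X).eval u ^ 2) := by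
    rw [← hprod, hΛ', hΛ]
    have : (1 - s) ^ 2 = s * (u - 2) := by linear_combination hquad
    linear_combination (s ^ (2 * N) * (halfCharpoly X).eval u ^ 2) * this
  have := mul_left_cancel₀ (pow_ne_zero _ hspos.ne') hmain
  simpa using this

theorem abs_le_two_of_halfCharpoly_root (h : X * Xᵀ = 1) (hd : X.det = 1) {y : ℝ}
    (hy : (halfCharpoly X).eval y = 0) : |y| ≤ 2 := by
  by_contra hlt
  push Not at hlt
  have hy4 : 4 < y ^ 2 := by
    rw [← sq_abs]; nlinarith
  set s : ℝ := (y + √(y ^ 2 - 4)) / 2 with hsdef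
  have hsq : √(y ^ 2 - 4) ^ 2 = y ^ 2 - 4 := Real.sq_sqrt (by nlinarith)
  have hquad : s ^ 2 + 1 = y * s := by rw [hsdef]; linear_combination hsq / 4
  have hs0 : s ≠ 0 := by rintro h0; rw [h0] at hquad; norm_num at hquad
  have hus : s + s⁻¹ = y := by field_simp; linarith
  have hs1 : s ^ 2 ≠ 1 := by
    intro h1
    have h3 : (y * s) ^ 2 = 4 := by rw [← hquad, h1]; norm_num
    rw [mul_pow, h1] at h3
    linarith
  have hΛ := det_one_sub_smul_transpose h hd hs0
  rw [hus, hy, mul_zero] at hΛ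
  obtain ⟨v, hv0, hv⟩ := Matrix.exists_mulVec_eq_zero_iff.mpr hΛ
  rw [Matrix.sub_mulVec, Matrix.one_mulVec, sub_eq_zero, Matrix.smul_mulVec] at hv
  have hvv : v ⬝ᵥ v = s ^ 2 * (v ⬝ᵥ v) := by
    conv_lhs => rw [hv]
    rw [smul_dotProduct, dotProduct_smul, Matrix.dotProduct_mulVec, Matrix.vecMul_mulVec,
      Matrix.transpose_transpose, h]
    simp [smul_eq_mul, pow_two, mul_assoc]
  have : v ⬝ᵥ v ≠ 0 := by rwa [Ne, dotProduct_self_eq_zero]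
  apply hs1
  field_simp at hvv
  exact hvv.symm

theorem exists_eigenvalue_param (h : X * Xᵀ = 1) (hd : X.det = 1) :
    ∃ y : Fin N → ℝ, (∀ j, |y j| ≤ 2) ∧
      (∀ s : ℝ, (1 - s • Xᵀ).det = (1 - s) * ∏ j, (1 + s ^ 2 - s * y j)) ∧
      ∀ k : ℕ, ((X + Xᵀ) ^ k).trace = 2 ^ k + 2 * ∑ j, y j ^ k := by
  have hherm : (X + Xᵀ).IsHermitian := by
    rw [Matrix.IsHermitian, Matrix.conjTranspose_eq_transpose_of_trivial]
    simp [add_comm]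
  obtain ⟨hmonic, hdeg⟩ := halfCharpoly_monic_natDegree (X := X)
  have hchar := charpoly_add_transpose h hd
  have hsplit : (halfCharpoly X).Splits :=
    hherm.splits_charpoly.of_dvd (Matrix.charpoly_monic _).ne_zero
      (hchar ▸ Dvd.dvd.mul_left (dvd_pow_self _ two_ne_zero) _)
  have hcard : (halfCharpoly X).roots.card = N := by
    rw [← hsplit.natDegree_eq_card_roots, hdeg]
  obtain ⟨y, hy⟩ : ∃ y : Fin N → ℝ, Finset.univ.val.map y = (halfCharpoly X).roots := by
    have hl : (halfCharpoly X).roots.toList.length = N := by simpa using hcard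
    refine ⟨fun j => (halfCharpoly X).roots.toList.get (j.cast hl.symm), ?_⟩
    conv_rhs => rw [← Multiset.coe_toList (halfCharpoly X).roots]
    rw [Fin.univ_val_map]
    congr 1
    apply List.ext_get <;> simp [hl]
  have hev : ∀ u, (halfCharpoly X).eval u = ∏ j, (u - y j) := by
    intro u
    conv_lhs => rw [hsplit.eq_prod_roots_of_monic hmonic, ← hy]
    rw [Multiset.map_map, ← Finset.prod_eq_multiset_prod, Polynomial.eval_prod]
    simp
  refine ⟨y, fun j => abs_le_two_of_halfCharpoly_root h hd ?_, fun s => ?_, fun k => ?_⟩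
  · rw [hev]
    exact Finset.prod_eq_zero (Finset.mem_univ j) (sub_self _)
  · by_cases hs : s = 0
    · simp [hs]
    · rw [det_one_sub_smul_transpose h hd hs, hev, mul_assoc]
      congr 1
      have : s ^ N = ∏ _j : Fin N, s := by simp
      rw [this, ← Finset.prod_mul_distrib]
      refine Finset.prod_congr rfl fun j _ => ?_
      field_simp
      ring
  · rw [trace_pow_eq_sum_eigenvalues_pow hherm]
    have hroots := hherm.roots_charpoly_eq_eigenvalues
    rw [hchar, Polynomial.roots_mul (mul_ne_zero (Polynomial.X_sub_C_ne_zero _)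
      (pow_ne_zero _ hmonic.ne_zero)), Polynomial.roots_X_sub_C, Polynomial.roots_pow, ← hy]
      at hroots
    have := congrArg (fun M => (Multiset.map (fun x => x ^ k) M).sum) hroots
    simp only [Multiset.map_add, Multiset.map_nsmul, Multiset.sum_add, Multiset.map_map,
      Multiset.sum_nsmul] at this
    simpa [Finset.sum, two_mul] using this.symm

end Spectral

section LoopAlgebra

open MvPolynomial

/-- Evaluation of the `l`-th variable at the `l`-th power sum in `N` variables. -/
def psumHom (N : ℕ) : MvPolynomial ℕ ℝ →ₐ[ℝ] MvPolynomial (Fin N) ℝ :=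
  aeval fun l => psum (Fin N) ℝ l

/-- The drift polynomial of the `k`-th loop equation. -/
def loopDrift (k : ℕ) : MvPolynomial ℕ ℝ :=
  ∑ i ∈ Finset.range (k + 2), X i * X (k + 1 - i) -
    4 * ∑ i ∈ Finset.range k, X i * X (k - 1 - i) + 2 * X k

/-- The derivation of the `k`-th loop equation, in power sum variables. -/
def loopDer (k : ℕ) : Derivation ℝ (MvPolynomial ℕ ℝ) (MvPolynomial ℕ ℝ) :=
  mkDerivation ℝ fun l => (l : MvPolynomial ℕ ℝ) * (X (k + l + 1) - 4 * X (k + l - 1))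

/-- The derivation `∑ (y_j ^ (k + 2) - 4 y_j ^ k) ∂_j`. -/
def fieldDer (N k : ℕ) : Derivation ℝ (MvPolynomial (Fin N) ℝ) (MvPolynomial (Fin N) ℝ) :=
  mkDerivation ℝ fun j => X j ^ (k + 2) - 4 * X j ^ k

/-- The eigenangle density as a polynomial in `y_j = 2 cos θ_j`. -/
def weightPoly (N : ℕ) : MvPolynomial (Fin N) ℝ :=
  C (2 ^ (N ^ 2) / (π ^ N * N.factorial)) *
    (∏ j : Fin N, ∏ k ∈ Finset.Ioi j, (C (1 / 2) * (X k - X j)) ^ 2) *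
    ∏ m : Fin N, (C (1 / 4) * (2 - X m))

theorem eval_weightPoly {N : ℕ} (θ : Fin N → ℝ) :
    eval (fun j => 2 * cos (θ j)) (weightPoly N) = densitySO N θ := by
  simp only [weightPoly, densitySO, map_mul, map_prod, map_pow, map_sub, eval_C, eval_X,
    map_ofNat]
  congr 1
  · congr 1
    refine Finset.prod_congr rfl fun j _ => Finset.prod_congr rfl fun k _ => ?_
    ring
  · refine Finset.prod_congr rfl fun j _ => ?_
    have h2 : cos (θ j) = 1 - 2 * sin (θ j / 2) ^ 2 := by
      rw [← cos_sq_add_sin_sq (θ j / 2)]; nth_rw 1 [show θ j = 2 * (θ j / 2) by ring]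
      rw [cos_two_mul']; ring
    rw [h2]; ring

theorem weightPoly_ne_zero (N : ℕ) : weightPoly N ≠ 0 := by
  refine mul_ne_zero (mul_ne_zero ?_ ?_) ?_
  · rw [Ne, map_eq_zero_iff _ (C_injective _ _)]
    positivity
  · refine Finset.prod_ne_zero_iff.mpr fun j _ => Finset.prod_ne_zero_iff.mpr fun k hk => ?_
    refine pow_ne_zero _ (mul_ne_zero ?_ ?_)
    · rw [Ne, map_eq_zero_iff _ (C_injective _ _)]; norm_num
    · rw [sub_ne_zero]
      intro h
      exact (Finset.mem_Ioi.mp hk).ne' (X_injective h)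
  · refine Finset.prod_ne_zero_iff.mpr fun j _ => mul_ne_zero ?_ ?_
    · rw [Ne, map_eq_zero_iff _ (C_injective _ _)]; norm_num
    · intro h
      have := congrArg (eval fun _ => (0 : ℝ)) h
      simp only [map_sub, map_ofNat, eval_X, map_zero] at this
      norm_num at this

theorem derivation_prod_of_eigen {ι A : Type*} [CommRing A] [Algebra ℝ A] (D : Derivation ℝ A A)
    (s : Finset ι) (f c : ι → A) (h : ∀ i ∈ s, D (f i) = c i * f i) :
    D (∏ i ∈ s, f i) = (∑ i ∈ s, c i) * ∏ i ∈ s, f i := by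
  classical
  induction s using Finset.induction_on with
  | empty => simp
  | insert a s ha ih =>
    rw [Finset.prod_insert ha, Finset.sum_insert ha, D.leibniz,
      ih fun i hi => h i (Finset.mem_insert_of_mem hi), h a (Finset.mem_insert_self _ _)]
    simp only [smul_eq_mul]
    ring

/-- The divided difference of `y ^ (k + 2) - 4 y ^ k`. -/
def divDiff {N : ℕ} (k : ℕ) (a b : Fin N) : MvPolynomial (Fin N) ℝ :=
  ∑ i ∈ Finset.range (k + 2), X a ^ i * X b ^ (k + 1 - i) -
    4 * ∑ i ∈ Finset.range k, X a ^ i * X b ^ (k - 1 - i)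

theorem divDiff_mul {N : ℕ} (k : ℕ) (a b : Fin N) :
    divDiff k a b * (X a - X b) = (X a ^ (k + 2) - 4 * X a ^ k) - (X b ^ (k + 2) - 4 * X b ^ k) := by
  have h1 := (Commute.all (X a : MvPolynomial (Fin N) ℝ) (X b)).geom_sum₂_mul (k + 2)
  have h2 := (Commute.all (X a : MvPolynomial (Fin N) ℝ) (X b)).geom_sum₂_mul k
  rw [show k + 2 - 1 = k + 1 by omega] at h1
  rw [divDiff]
  linear_combination h1 - 4 * h2

theorem divDiff_comm {N : ℕ} (k : ℕ) (a b : Fin N) : divDiff k a b = divDiff k b a := by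
  by_cases h : a = b
  · rw [h]
  · have h0 : (X a - X b : MvPolynomial (Fin N) ℝ) ≠ 0 :=
      sub_ne_zero.mpr fun h' => h (X_injective h')
    refine mul_right_cancel₀ h0 ?_
    linear_combination divDiff_mul k a b + divDiff_mul k b a

theorem divDiff_self {N : ℕ} (k : ℕ) (a : Fin N) :
    divDiff k a a = ((k : MvPolynomial (Fin N) ℝ) + 2) * X a ^ (k + 1) -
      4 * ((k : MvPolynomial (Fin N) ℝ) * X a ^ (k - 1)) := by
  rw [divDiff]
  congr 1
  · rw [Finset.sum_congr rfl (g := fun _ => X a ^ (k + 1))]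
    · simp
    · intro i hi
      rw [← pow_add]; congr 1; have := Finset.mem_range.mp hi; omega
  · rw [Finset.sum_congr rfl (g := fun _ => X a ^ (k - 1))]
    · simp
    · intro i hi
      rw [← pow_add]; congr 1; have := Finset.mem_range.mp hi; omega

theorem fieldDer_weightPoly (N k : ℕ) :
    fieldDer N k (weightPoly N) = ((∑ j : Fin N, ∑ l ∈ Finset.Ioi j, 2 * divDiff k l j) +
      ∑ j : Fin N, (2 * X j ^ k + X j ^ (k + 1))) * weightPoly N := by
  have hC : ∀ (c : ℝ) (f g : MvPolynomial (Fin N) ℝ), fieldDer N k f = g * f →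
      fieldDer N k (C c * f) = g * (C c * f) := by
    intro c f g h
    rw [Derivation.leibniz, h, ← algebraMap_eq, Derivation.map_algebraMap]
    simp only [smul_eq_mul]; ring
  have h1 : fieldDer N k (∏ j : Fin N, ∏ l ∈ Finset.Ioi j, (C (1 / 2) * (X l - X j)) ^ 2) =
      (∑ j : Fin N, ∑ l ∈ Finset.Ioi j, 2 * divDiff k l j) *
        ∏ j : Fin N, ∏ l ∈ Finset.Ioi j, (C (1 / 2) * (X l - X j)) ^ 2 := by
    refine derivation_prod_of_eigen _ _ _ _ fun j _ => derivation_prod_of_eigen _ _ _ _ fun l _ => ?_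
    have : fieldDer N k (C (1 / 2) * (X l - X j)) = divDiff k l j * (C (1 / 2) * (X l - X j)) := by
      apply hC
      rw [map_sub, fieldDer, mkDerivation_X, mkDerivation_X, divDiff_mul]
    rw [pow_two, Derivation.leibniz, this]
    simp only [smul_eq_mul]; ring
  have h2 : fieldDer N k (∏ m : Fin N, (C (1 / 4) * (2 - X m))) =
      (∑ j : Fin N, (2 * X j ^ k + X j ^ (k + 1))) * ∏ m : Fin N, (C (1 / 4) * (2 - X m)) := by
    refine derivation_prod_of_eigen _ _ _ _ fun j _ => hC _ _ _ ?_
    rw [map_sub, show (2 : MvPolynomial (Fin N) ℝ) = algebraMap ℝ _ 2 from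
      (map_ofNat (algebraMap ℝ (MvPolynomial (Fin N) ℝ)) 2).symm,
      Derivation.map_algebraMap, fieldDer, mkDerivation_X]
    simp only [map_ofNat]; ring
  rw [weightPoly, mul_assoc]
  apply hC
  rw [Derivation.leibniz, h1, h2]
  simp only [smul_eq_mul]; ring

theorem psumHom_loopDrift (N k : ℕ) :
    psumHom N (loopDrift k) = ∑ a, ∑ b, divDiff k a b + 2 * psum (Fin N) ℝ k := by
  have hc : ∀ (n : ℕ) (e : ℕ → ℕ), ∑ a : Fin N, ∑ b : Fin N, ∑ i ∈ Finset.range n,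
      (X a ^ i * X b ^ (e i) : MvPolynomial (Fin N) ℝ) =
      ∑ i ∈ Finset.range n, psum (Fin N) ℝ i * psum (Fin N) ℝ (e i) := by
    intro n e
    have : ∀ a : Fin N, ∑ b : Fin N, ∑ i ∈ Finset.range n,
        (X a ^ i * X b ^ (e i) : MvPolynomial (Fin N) ℝ) =
        ∑ i ∈ Finset.range n, ∑ b : Fin N, X a ^ i * X b ^ (e i) := fun a => Finset.sum_comm
    simp only [this]
    rw [Finset.sum_comm]
    refine Finset.sum_congr rfl fun i _ => ?_
    rw [psum, psum, Finset.sum_mul_sum]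
  simp only [divDiff, Finset.sum_sub_distrib, ← Finset.mul_sum]
  rw [hc, hc (e := fun i => k - 1 - i)]
  simp only [psumHom, loopDrift, map_add, map_sub, map_mul, map_sum, aeval_X, map_ofNat]

/-- The divergence of the `k`-th vector field with respect to the eigenangle density. -/
theorem loop_divergence (N k : ℕ) :
    (∑ j : Fin N, (X j ^ (k + 1) + (k : MvPolynomial (Fin N) ℝ) *
      (X j ^ (k + 1) - 4 * X j ^ (k - 1)))) * weightPoly N +
      fieldDer N k (weightPoly N) = psumHom N (loopDrift k) * weightPoly N := by
  rw [fieldDer_weightPoly, ← add_mul, psumHom_loopDrift]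
  congr 1
  have h1 : ∑ j : Fin N, ∑ l ∈ Finset.Ioi j, 2 * divDiff k l j =
      ∑ a : Fin N, ∑ b, divDiff k a b - ∑ a : Fin N, divDiff k a a := by
    have h2 := Finset.sum_sum_Ioi_add_eq_sum_sum_off_diag (fun a b : Fin N => divDiff k a b)
    have h3 : ∀ i : Fin N, ∑ j ∈ {i}ᶜ, divDiff k j i = ∑ b, divDiff k i b - divDiff k i i := by
      intro i
      rw [eq_sub_iff_add_eq, ← Finset.sum_compl_add_sum {i}, Finset.sum_singleton]
      congr 1
      exact Finset.sum_congr rfl fun j _ => divDiff_comm k j i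
    rw [Finset.sum_congr rfl fun i _ => h3 i, Finset.sum_sub_distrib] at h2
    rw [← h2]
    refine Finset.sum_congr rfl fun i _ => Finset.sum_congr rfl fun j _ => ?_
    rw [divDiff_comm k i j]; ring
  rw [h1, psum]
  simp only [divDiff_self, Finset.mul_sum]
  have h4 : ∑ j : Fin N, (X j ^ (k + 1) + (k : MvPolynomial (Fin N) ℝ) *
      (X j ^ (k + 1) - 4 * X j ^ (k - 1))) + ∑ j : Fin N, (2 * X j ^ k + X j ^ (k + 1)) =
      ∑ j : Fin N, (((k : MvPolynomial (Fin N) ℝ) + 2) * X j ^ (k + 1) -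
        4 * ((k : MvPolynomial (Fin N) ℝ) * X j ^ (k - 1))) + ∑ j : Fin N, 2 * X j ^ k := by
    rw [← Finset.sum_add_distrib, ← Finset.sum_add_distrib]
    refine Finset.sum_congr rfl fun j _ => ?_
    ring
  linear_combination h4

theorem psumHom_loopDer (N k : ℕ) (P : MvPolynomial ℕ ℝ) :
    psumHom N (loopDer k P) = fieldDer N k (psumHom N P) := by
  induction P using MvPolynomial.induction_on with
  | C a => rw [← algebraMap_eq, Derivation.map_algebraMap, AlgHom.commutes,
      Derivation.map_algebraMap, map_zero]
  | add p q hp hq => simp only [map_add, hp, hq]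
  | mul_X p l hp =>
    have hX : psumHom N (loopDer k (X l)) = fieldDer N k (psumHom N (X l)) := by
      simp only [psumHom, loopDer, fieldDer, mkDerivation_X, aeval_X, map_mul, map_sub, map_natCast,
        map_ofNat, psum, map_sum, Derivation.leibniz_pow, smul_eq_mul, nsmul_eq_mul]
      rw [Finset.mul_sum, ← Finset.sum_sub_distrib, Finset.mul_sum]
      refine Finset.sum_congr rfl fun j _ => ?_
      rcases l with _ | l
      · simp
      · rw [show k + (l + 1) + 1 = l + (k + 2) by omega, show k + (l + 1) - 1 = l + k by omega,
          Nat.add_sub_cancel]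
        ring
    rw [Derivation.leibniz, map_add, map_mul (psumHom N) p, Derivation.leibniz]
    simp only [smul_eq_mul, map_mul, hp, hX]

/-- The coefficient of the `k`-th vector field in the gradient of `P`. -/
def gradCoeff (k : ℕ) (P : MvPolynomial ℕ ℝ) : MvPolynomial ℕ ℝ :=
  (k + 1 : MvPolynomial ℕ ℝ) * pderiv (k + 1) P

theorem exists_pderiv_psumHom (N : ℕ) (P : MvPolynomial ℕ ℝ) : ∃ M₀, ∀ M ≥ M₀, ∀ j : Fin N,
    pderiv j (psumHom N P) = ∑ k ∈ Finset.range M, psumHom N (gradCoeff k P) * X j ^ k := by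
  induction P using MvPolynomial.induction_on with
  | C a =>
    refine ⟨0, fun M _ j => ?_⟩
    rw [← algebraMap_eq, AlgHom.commutes, Derivation.map_algebraMap]
    simp [gradCoeff]
  | add p q hp hq =>
    obtain ⟨M₁, h₁⟩ := hp
    obtain ⟨M₂, h₂⟩ := hq
    refine ⟨max M₁ M₂, fun M hM j => ?_⟩
    rw [map_add, map_add, h₁ M (le_of_max_le_left hM), h₂ M (le_of_max_le_right hM),
      ← Finset.sum_add_distrib]
    refine Finset.sum_congr rfl fun k _ => ?_
    simp only [gradCoeff, map_add, map_mul]; ring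
  | mul_X p l hp =>
    obtain ⟨M₁, h₁⟩ := hp
    refine ⟨max M₁ l, fun M hM j => ?_⟩
    have hsum : pderiv j (psumHom N (X l)) =
        ∑ k ∈ Finset.range M, psumHom N (gradCoeff k (X l)) * X j ^ k := by
      have h1 : pderiv j (psumHom N (X l)) = (l : MvPolynomial (Fin N) ℝ) * X j ^ (l - 1) := by
        simp only [psumHom, aeval_X, psum, map_sum, Derivation.leibniz_pow, smul_eq_mul,
          nsmul_eq_mul, pderiv_X]
        rw [Finset.sum_eq_single j]
        · simp
        · intro b _ hb
          simp [hb]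
        · simp
      rw [h1]
      rcases l with _ | l
      · rw [Finset.sum_eq_zero]
        · simp
        · intro k _
          simp [gradCoeff, pderiv_X]
      · rw [Finset.sum_eq_single l]
        · simp [gradCoeff]
        · intro k _ hk
          simp [gradCoeff, pderiv_X, hk.symm]
        · intro h
          exact absurd (Finset.mem_range.mpr (le_of_max_le_right hM)) h
    rw [map_mul, Derivation.leibniz, h₁ M (le_of_max_le_left hM), hsum, smul_eq_mul, smul_eq_mul,
      Finset.mul_sum, Finset.mul_sum, ← Finset.sum_add_distrib]
    refine Finset.sum_congr rfl fun k _ => ?_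
    simp only [gradCoeff, Derivation.leibniz, map_mul, map_add, smul_eq_mul]
    ring

theorem fieldDer_eq_sum_pderiv (N k : ℕ) (g : MvPolynomial (Fin N) ℝ) :
    fieldDer N k g = ∑ j, (X j ^ (k + 2) - 4 * X j ^ k) * pderiv j g := by
  induction g using MvPolynomial.induction_on with
  | C a => simp only [← algebraMap_eq, Derivation.map_algebraMap, mul_zero, Finset.sum_const_zero]
  | add p q hp hq => simp only [map_add, hp, hq, mul_add, Finset.sum_add_distrib]
  | mul_X p i hp =>
    have hX : fieldDer N k (X i) = ∑ j, (X j ^ (k + 2) - 4 * X j ^ k) * pderiv j (X i) := by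
      rw [fieldDer, mkDerivation_X, Finset.sum_eq_single i]
      · simp
      · intro b _ hb
        simp [pderiv_X, hb.symm]
      · simp
    rw [Derivation.leibniz, hp, hX, smul_eq_mul, smul_eq_mul, Finset.mul_sum, Finset.mul_sum,
      ← Finset.sum_add_distrib]
    refine Finset.sum_congr rfl fun j _ => ?_
    rw [Derivation.leibniz, smul_eq_mul, smul_eq_mul]
    ring

end LoopAlgebra

section LoopFiltration

open MvPolynomial

/-- Polynomials of weight at most `d`, where the `l`-th variable has weight `l`. -/
def weightLE (d : ℕ) : Submodule ℝ (MvPolynomial ℕ ℝ) where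
  carrier := {P | ∀ m, coeff m P ≠ 0 → Finsupp.weight (id : ℕ → ℕ) m ≤ d}
  zero_mem' := fun m h => absurd (coeff_zero m) h
  add_mem' := fun {P Q} hP hQ m h => by
    by_cases hm : coeff m P = 0
    · refine hQ m fun h' => h ?_
      rw [coeff_add, hm, h', add_zero]
    · exact hP m hm
  smul_mem' := fun c P hP m h => hP m fun h' => h (by rw [coeff_smul, h', smul_zero])

theorem weightLE_mono {d e : ℕ} (h : d ≤ e) : weightLE d ≤ weightLE e :=
  fun _ hP m hm => (hP m hm).trans h

theorem monomial_mem_weightLE {d : ℕ} {m : ℕ →₀ ℕ} (c : ℝ)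
    (h : Finsupp.weight (id : ℕ → ℕ) m ≤ d) : monomial m c ∈ weightLE d := by
  intro m' hm'
  rw [coeff_monomial] at hm'
  by_cases h' : m = m'
  · exact h' ▸ h
  · exact absurd (if_neg h') hm'

theorem X_mem_weightLE (l : ℕ) : (X l : MvPolynomial ℕ ℝ) ∈ weightLE l :=
  monomial_mem_weightLE _ (by simp [Finsupp.weight_single])

theorem C_mem_weightLE (c : ℝ) (d : ℕ) : (C c : MvPolynomial ℕ ℝ) ∈ weightLE d :=
  monomial_mem_weightLE _ (by simp)

theorem mul_mem_weightLE {d e : ℕ} {P Q : MvPolynomial ℕ ℝ} (hP : P ∈ weightLE d)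
    (hQ : Q ∈ weightLE e) : P * Q ∈ weightLE (d + e) := by
  intro m hm
  rw [coeff_mul] at hm
  obtain ⟨x, hx, hne⟩ := Finset.exists_ne_zero_of_sum_ne_zero hm
  rw [← Finset.HasAntidiagonal.mem_antidiagonal.mp hx, map_add]
  exact add_le_add (hP _ (left_ne_zero_of_mul hne)) (hQ _ (right_ne_zero_of_mul hne))

theorem natCast_mul_mem_weightLE {d : ℕ} {P : MvPolynomial ℕ ℝ} (n : ℕ) (hP : P ∈ weightLE d) :
    (n : MvPolynomial ℕ ℝ) * P ∈ weightLE d := by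
  rw [← nsmul_eq_mul]
  exact (weightLE d).nsmul_mem hP n

theorem exists_mem_weightLE (P : MvPolynomial ℕ ℝ) : ∃ d, P ∈ weightLE d :=
  ⟨P.support.sup fun m => Finsupp.weight (id : ℕ → ℕ) m, fun _ hm =>
    Finset.le_sup (f := fun m => Finsupp.weight (id : ℕ → ℕ) m) (mem_support_iff.mpr hm)⟩

theorem induction_weightLE {d : ℕ} {P : MvPolynomial ℕ ℝ} (hP : P ∈ weightLE d)
    {V : Type*} [AddCommGroup V] [Module ℝ V] (f : MvPolynomial ℕ ℝ →ₗ[ℝ] V) (W : Submodule ℝ V)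
    (h : ∀ m c, Finsupp.weight (id : ℕ → ℕ) m ≤ d → f (monomial m c) ∈ W) : f P ∈ W := by
  rw [P.as_sum, map_sum]
  exact W.sum_mem fun m hm => h _ _ (hP m (mem_support_iff.mp hm))

theorem loopDrift_mem_weightLE (k : ℕ) : loopDrift k ∈ weightLE (k + 1) := by
  have h4 : ∀ (n d : ℕ) (P : MvPolynomial ℕ ℝ), P ∈ weightLE d →
      (n : MvPolynomial ℕ ℝ) * P ∈ weightLE d := fun n d P h => natCast_mul_mem_weightLE n h
  refine (weightLE _).add_mem ((weightLE _).sub_mem ((weightLE _).sum_mem fun i hi => ?_)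
    (h4 4 _ _ ((weightLE _).sum_mem fun i hi => ?_))) (h4 2 _ _ ?_)
  · refine weightLE_mono ?_ (mul_mem_weightLE (X_mem_weightLE _) (X_mem_weightLE _))
    have := Finset.mem_range.mp hi
    omega
  · refine weightLE_mono ?_ (mul_mem_weightLE (X_mem_weightLE _) (X_mem_weightLE _))
    have := Finset.mem_range.mp hi
    omega
  · exact weightLE_mono (by omega) (X_mem_weightLE _)

theorem loopDer_mem_weightLE (k : ℕ) {d : ℕ} {P : MvPolynomial ℕ ℝ} (hP : P ∈ weightLE d) :
    loopDer k P ∈ weightLE (d + (k + 1)) := by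
  refine induction_weightLE hP (loopDer k).toLinearMap _ fun m c hm => ?_
  change loopDer k (monomial m c) ∈ _
  rw [loopDer, mkDerivation_monomial]
  refine (weightLE _).smul_mem _ ((weightLE _).sum_mem fun l hl => ?_)
  have hw := Finsupp.weight_sub_single_add (w := (id : ℕ → ℕ)) (Finsupp.mem_support_iff.mp hl)
  simp only [smul_eq_mul]
  rw [id] at hw
  refine weightLE_mono (d := (d - l) + (l + (k + 1))) (by omega) (mul_mem_weightLE
    (monomial_mem_weightLE _ (by omega)) (natCast_mul_mem_weightLE _ ((weightLE _).sub_mem ?_ ?_)))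
  · exact weightLE_mono (by omega) (X_mem_weightLE _)
  · exact natCast_mul_mem_weightLE 4 (weightLE_mono (by omega) (X_mem_weightLE _))

theorem gradCoeff_mem_weightLE (k : ℕ) {d : ℕ} {P : MvPolynomial ℕ ℝ} (hP : P ∈ weightLE d)
    (hk : k + 1 ≤ d) : gradCoeff k P ∈ weightLE (d - (k + 1)) := by
  have h := natCast_mul_mem_weightLE (P := pderiv (k + 1) P) (d := d - (k + 1)) (k + 1) ?_
  · rwa [Nat.cast_add, Nat.cast_one] at h
  · intro m hm
    rw [coeff_pderiv] at hm
    have := hP _ (left_ne_zero_of_mul hm)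
    rw [map_add, Finsupp.weight_single] at this
    simp only [id, one_smul] at this
    omega

theorem gradCoeff_eq_zero (k : ℕ) {d : ℕ} {P : MvPolynomial ℕ ℝ} (hP : P ∈ weightLE d)
    (hk : d < k + 1) : gradCoeff k P = 0 := by
  have : pderiv (k + 1) P = 0 := by
    ext m
    rw [coeff_pderiv, coeff_zero]
    by_contra hm
    have := hP _ (left_ne_zero_of_mul hm)
    rw [map_add, Finsupp.weight_single] at this
    simp only [id, one_smul] at this
    omega
  rw [gradCoeff, this, mul_zero]

/-- The generator of the circular diffusion does not raise the weight. -/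
theorem loop_gradCoeff_mem_weightLE (M : ℕ) {d : ℕ} {P : MvPolynomial ℕ ℝ} (hP : P ∈ weightLE d) :
    ∑ k ∈ Finset.range M, (loopDrift k * gradCoeff k P + loopDer k (gradCoeff k P)) ∈
      weightLE d := by
  refine (weightLE d).sum_mem fun k _ => ?_
  by_cases hk : k + 1 ≤ d
  · have h := gradCoeff_mem_weightLE k hP hk
    exact (weightLE d).add_mem
      (weightLE_mono (by omega) (mul_mem_weightLE (loopDrift_mem_weightLE k) h))
      (weightLE_mono (by omega) (loopDer_mem_weightLE k h))
  · rw [gradCoeff_eq_zero k hP (by omega), mul_zero, map_zero, add_zero]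
    exact (weightLE d).zero_mem

theorem map_weightLE_le (N d : ℕ) :
    (weightLE d).map (psumHom N).toLinearMap ≤ restrictTotalDegree (Fin N) ℝ d := by
  rintro _ ⟨P, hP, rfl⟩
  refine induction_weightLE hP (psumHom N).toLinearMap _ fun m c hm => ?_
  rw [mem_restrictTotalDegree, AlgHom.toLinearMap_apply, psumHom, aeval_monomial, algebraMap_eq]
  refine (totalDegree_mul _ _).trans ?_
  rw [totalDegree_C, zero_add]
  refine (totalDegree_finsetProd _ _).trans ?_
  rw [Finsupp.weight_apply] at hm
  refine le_trans (Finset.sum_le_sum fun l _ => ?_) hm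
  refine (totalDegree_pow _ _).trans (Nat.mul_le_mul_left _ ?_)
  refine (totalDegree_finsetSum _ _).trans (Finset.sup_le fun j _ => ?_)
  rw [totalDegree_X_pow]
  rfl

instance finiteDimensional_map_weightLE (N d : ℕ) :
    FiniteDimensional ℝ ((weightLE d).map (psumHom N).toLinearMap) :=
  Submodule.finiteDimensional_of_le (map_weightLE_le N d)

end LoopFiltration

section EigenangleFunctional

open MvPolynomial

/-- The eigenangle domain `[0, π]^N`. -/
abbrev angleBox (N : ℕ) : Set (Fin N → ℝ) := Set.univ.pi fun _ => Set.Icc (0 : ℝ) π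

theorem isCompact_angleBox (N : ℕ) : IsCompact (angleBox N) :=
  isCompact_univ_pi fun _ => isCompact_Icc

theorem continuous_eval_two_cos {N : ℕ} (p : MvPolynomial (Fin N) ℝ) :
    Continuous fun θ : Fin N → ℝ => eval (fun j => 2 * cos (θ j)) p :=
  (continuous_eval p).comp (by fun_prop)

theorem integrableOn_angleBox {N : ℕ} {f : (Fin N → ℝ) → ℝ} (hf : Continuous f) :
    IntegrableOn f (angleBox N) :=
  hf.continuousOn.integrableOn_compact (isCompact_angleBox N)

/-- Integration of a polynomial in `y_j = 2 cos θ_j` against the eigenangle density. -/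
def angleInt (N : ℕ) : MvPolynomial (Fin N) ℝ →ₗ[ℝ] ℝ where
  toFun g := ∫ θ in angleBox N, eval (fun j => 2 * cos (θ j)) (g * weightPoly N)
  map_add' f g := by
    simp only [add_mul, map_add]
    exact integral_add (integrableOn_angleBox (continuous_eval_two_cos _))
      (integrableOn_angleBox (continuous_eval_two_cos _))
  map_smul' c f := by
    simp only [smul_mul_assoc, smul_eval, RingHom.id_apply, smul_eq_mul]
    exact integral_const_mul _ _

theorem angleInt_apply {N : ℕ} (g : MvPolynomial (Fin N) ℝ) :
    angleInt N g = ∫ θ in angleBox N, eval (fun j => 2 * cos (θ j)) g * densitySO N θ := by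
  simp only [← eval_weightPoly, ← map_mul]
  rfl

theorem hasFDerivAt_eval_two_cos {N : ℕ} (p : MvPolynomial (Fin N) ℝ) (θ : Fin N → ℝ) :
    HasFDerivAt (fun θ : Fin N → ℝ => eval (fun j => 2 * cos (θ j)) p)
      (∑ i, (eval (fun j => 2 * cos (θ j)) (pderiv i p) * (-(2 * sin (θ i)))) •
        (ContinuousLinearMap.proj i : (Fin N → ℝ) →L[ℝ] ℝ)) θ := by
  induction p using MvPolynomial.induction_on with
  | C a =>
    simp only [eval_C, pderiv_C, map_zero, zero_mul, zero_smul, Finset.sum_const_zero]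
    exact hasFDerivAt_const _ _
  | add p q hp hq =>
    simp only [map_add, add_mul, add_smul, Finset.sum_add_distrib]
    exact hp.add hq
  | mul_X p l hp =>
    have h1 : HasFDerivAt (fun θ : Fin N → ℝ => 2 * cos (θ l))
        ((-(2 * sin (θ l))) • (ContinuousLinearMap.proj l : (Fin N → ℝ) →L[ℝ] ℝ)) θ := by
      have := ((hasFDerivAt_apply (𝕜 := ℝ) l θ).cos).const_mul 2
      refine this.congr_fderiv ?_
      rw [smul_smul]
      congr 1
      ring
    have h2 := hp.mul h1
    simp only [map_mul, eval_X]
    refine h2.congr_fderiv ?_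
    rw [Finset.smul_sum]
    ext v
    simp only [_root_.sum_apply, _root_.smul_apply, _root_.add_apply,
      ContinuousLinearMap.proj_apply, smul_eq_mul, pderiv_mul,
      map_add, map_mul, eval_X]
    have h3 : eval (fun j => 2 * cos (θ j)) p * (-(2 * sin (θ l)) * v l) =
        ∑ i, eval (fun j => 2 * cos (θ j)) p * eval (fun j => 2 * cos (θ j))
          (pderiv i (X l)) *
          (-(2 * sin (θ i)) * v i) := by
      rw [Finset.sum_eq_single l]
      · simp
      · intro b _ hb
        simp [pderiv_X_of_ne hb.symm]
      · simp
    rw [h3, ← Finset.sum_add_distrib]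
    refine Finset.sum_congr rfl fun i _ => ?_
    ring

/-- The loop equations for the eigenangle density. -/
theorem angleInt_loop (N k : ℕ) (g : MvPolynomial (Fin N) ℝ) :
    angleInt N (psumHom N (loopDrift k) * g + fieldDer N k g) = 0 := by
  set G := g * weightPoly N with hG
  have key : (psumHom N (loopDrift k) * g + fieldDer N k g) * weightPoly N =
      ∑ j : Fin N, ((X j ^ (k + 1) + (k : MvPolynomial (Fin N) ℝ) *
        (X j ^ (k + 1) - 4 * X j ^ (k - 1))) * G + (X j ^ (k + 2) - 4 * X j ^ k) * pderiv j G) := by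
    rw [Finset.sum_add_distrib, ← fieldDer_eq_sum_pderiv, ← Finset.sum_mul, hG,
      Derivation.leibniz]
    simp only [smul_eq_mul]
    linear_combination -g * loop_divergence N k
  change ∫ θ in angleBox N, eval (fun j => 2 * cos (θ j)) _ = 0
  rw [key]
  rcases N with _ | n
  · simp
  have hpi : (0 : Fin (n + 1) → ℝ) ≤ fun _ => π := fun _ => pi_pos.le
  have hpt : ∀ θ : Fin (n + 1) → ℝ, (∑ j, ((2 * sin (θ j) * (2 * cos (θ j)) ^ k) •
        (∑ i, (eval (fun j => 2 * cos (θ j)) (pderiv i G) * (-(2 * sin (θ i)))) •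
        (ContinuousLinearMap.proj i : (Fin (n + 1) → ℝ) →L[ℝ] ℝ)) +
      eval (fun j => 2 * cos (θ j)) G • (2 * cos (θ j) * (2 * cos (θ j)) ^ k +
        2 * sin (θ j) * (k * (2 * cos (θ j)) ^ (k - 1) * (-(2 * sin (θ j))))) •
        (ContinuousLinearMap.proj j : (Fin (n + 1) → ℝ) →L[ℝ] ℝ)) (Pi.single j 1)) =
      eval (fun j => 2 * cos (θ j)) (∑ j : Fin (n + 1), ((X j ^ (k + 1) +
        (k : MvPolynomial (Fin (n + 1)) ℝ) * (X j ^ (k + 1) - 4 * X j ^ (k - 1))) * G +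
          (X j ^ (k + 2) - 4 * X j ^ k) * pderiv j G)) := by
    intro θ
    rw [map_sum]
    refine Finset.sum_congr rfl fun j _ => ?_
    simp only [_root_.sum_apply, _root_.smul_apply, _root_.add_apply,
      ContinuousLinearMap.proj_apply, smul_eq_mul, map_add, map_mul, map_sub, map_pow, eval_X,
      map_ofNat, map_natCast]
    rw [Finset.sum_eq_single j]
    · rw [Pi.single_eq_same]
      have hs : sin (θ j) ^ 2 = 1 - cos (θ j) ^ 2 := sin_sq _
      rcases k with _ | k
      · simp only [pow_zero, Nat.cast_zero]
        linear_combination -4 * eval (fun j => 2 * cos (θ j)) (pderiv j G) * hs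
      · rw [Nat.add_sub_cancel]
        push_cast
        linear_combination (-4 * (2 * cos (θ j)) ^ (k + 1) *
          eval (fun j => 2 * cos (θ j)) (pderiv j G) - 4 * (k + 1) * (2 * cos (θ j)) ^ k *
          eval (fun j => 2 * cos (θ j)) G) * hs
    · intro b _ hb
      simp [hb]
    · simp
  have hdiv := integral_divergence_of_hasFDerivAt_off_countable' (0 : Fin (n + 1) → ℝ)
    (fun _ => π) hpi
    (fun j θ => 2 * sin (θ j) * (2 * cos (θ j)) ^ k * eval (fun j => 2 * cos (θ j)) G)
    (fun j θ => (2 * sin (θ j) * (2 * cos (θ j)) ^ k) •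
        (∑ i, (eval (fun j => 2 * cos (θ j)) (pderiv i G) * (-(2 * sin (θ i)))) •
        (ContinuousLinearMap.proj i : (Fin (n + 1) → ℝ) →L[ℝ] ℝ)) +
      eval (fun j => 2 * cos (θ j)) G • (2 * cos (θ j) * (2 * cos (θ j)) ^ k +
        2 * sin (θ j) * (k * (2 * cos (θ j)) ^ (k - 1) * (-(2 * sin (θ j))))) •
        (ContinuousLinearMap.proj j : (Fin (n + 1) → ℝ) →L[ℝ] ℝ))
    ∅ Set.countable_empty ?_ ?_ ?_
  · simp only [hpt] at hdiv
    rw [angleBox, Set.pi_univ_Icc, ← Pi.zero_def, hdiv]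
    simp
  · intro j
    exact Continuous.continuousOn ((by fun_prop : Continuous fun θ : Fin (n + 1) → ℝ =>
      2 * sin (θ j) * (2 * cos (θ j)) ^ k).mul (continuous_eval_two_cos G))
  · intro θ _ j
    have h1 : HasFDerivAt (fun θ : Fin (n + 1) → ℝ => 2 * sin (θ j) * (2 * cos (θ j)) ^ k)
        ((2 * cos (θ j) * (2 * cos (θ j)) ^ k +
        2 * sin (θ j) * (k * (2 * cos (θ j)) ^ (k - 1) * (-(2 * sin (θ j))))) •
        (ContinuousLinearMap.proj j : (Fin (n + 1) → ℝ) →L[ℝ] ℝ)) θ := by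
      have h0 : HasDerivAt (fun t : ℝ => 2 * sin t * (2 * cos t) ^ k)
          (2 * cos (θ j) * (2 * cos (θ j)) ^ k +
        2 * sin (θ j) * (k * (2 * cos (θ j)) ^ (k - 1) * (-(2 * sin (θ j))))) (θ j) := by
        have := ((hasDerivAt_sin (θ j)).const_mul 2).mul (((hasDerivAt_cos (θ j)).const_mul 2).pow k)
        refine this.congr_deriv ?_
        rw [Pi.pow_apply]
        ring
      exact h0.comp_hasFDerivAt θ (hasFDerivAt_apply (𝕜 := ℝ) j θ)
    exact h1.mul (hasFDerivAt_eval_two_cos G θ)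
  · simp only [hpt]
    exact (continuous_eval_two_cos _).continuousOn.integrableOn_compact isCompact_Icc

end EigenangleFunctional

section EigenanglePositivity

open MvPolynomial

theorem densitySO_nonneg (N : ℕ) (θ : Fin N → ℝ) : 0 ≤ densitySO N θ := by
  rw [densitySO]
  have := pi_pos
  refine mul_nonneg (mul_nonneg (by positivity) ?_) ?_
  · exact Finset.prod_nonneg fun _ _ => Finset.prod_nonneg fun _ _ => sq_nonneg _
  · exact Finset.prod_nonneg fun _ _ => sq_nonneg _

theorem abs_two_mul_cos_le (t : ℝ) : |2 * cos t| ≤ 2 := by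
  rw [abs_mul, abs_two]
  linarith [abs_cos_le_one t]

theorem eq_zero_of_angleInt_eq_zero {N : ℕ} {h : MvPolynomial (Fin N) ℝ}
    (hnn : ∀ y : Fin N → ℝ, (∀ j, |y j| ≤ 2) → 0 ≤ eval y h) (h0 : angleInt N h = 0) : h = 0 := by
  have hF : ∀ θ : Fin N → ℝ, 0 ≤ eval (fun j => 2 * cos (θ j)) (h * weightPoly N) := by
    intro θ
    rw [map_mul, eval_weightPoly]
    exact mul_nonneg (hnn _ fun j => abs_two_mul_cos_le _) (densitySO_nonneg N θ)
  have hc := continuous_eval_two_cos (h * weightPoly N)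
  change ∫ θ in angleBox N, eval (fun j => 2 * cos (θ j)) (h * weightPoly N) = 0 at h0
  rw [integral_eq_zero_iff_of_nonneg hF (integrableOn_angleBox hc)] at h0
  have hU : IsOpen (Set.univ.pi fun _ : Fin N => Set.Ioo (0 : ℝ) π) :=
    isOpen_set_pi Set.finite_univ fun _ _ => isOpen_Ioo
  have hsub : (Set.univ.pi fun _ : Fin N => Set.Ioo (0 : ℝ) π) ⊆ angleBox N :=
    Set.pi_mono fun _ _ => Set.Ioo_subset_Icc_self
  have heq := Measure.eqOn_open_of_ae_eq (ae_restrict_of_ae_restrict_of_subset hsub h0) hU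
    hc.continuousOn continuousOn_const
  have hz : h * weightPoly N = 0 := by
    refine funext_set (fun _ => Set.Ioo (-2 : ℝ) 2) (fun _ => Set.Ioo_infinite (by norm_num)) ?_
    intro y hy
    have hy' : ∀ j, y j ∈ Set.Ioo (-2 : ℝ) 2 := fun j => hy j (Set.mem_univ j)
    have hθ := @heq (fun j => arccos (y j / 2)) (fun j _ => ?_)
    · have : (fun j => 2 * cos (arccos (y j / 2))) = y := by
        funext j
        rw [cos_arccos (by linarith [(hy' j).1]) (by linarith [(hy' j).2])]
        ring
      simp only [this] at hθ
      rw [hθ, map_zero]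
      rfl
    · constructor
      · rw [arccos_pos]
        linarith [(hy' j).2]
      · refine lt_of_le_of_ne (arccos_le_pi _) fun h' => ?_
        rw [arccos_eq_pi] at h'
        linarith [(hy' j).1]
  exact (mul_eq_zero.mp hz).resolve_right (weightPoly_ne_zero N)

theorem integral_cos_int_mul (m : ℤ) :
    ∫ t in (0 : ℝ)..π, cos (m * t) = if m = 0 then π else 0 := by
  split_ifs with h
  · simp [h]
  · have hm : (m : ℝ) ≠ 0 := Int.cast_ne_zero.mpr h
    rw [intervalIntegral.integral_comp_mul_left (fun t => cos t) hm, integral_cos, sin_int_mul_pi]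
    simp

theorem integral_sin_mul_sin (a b : ℕ) :
    ∫ t in Set.Icc (0 : ℝ) π, sin ((a + 1 / 2) * t) * sin ((b + 1 / 2) * t) =
      if a = b then π / 2 else 0 := by
  rw [integral_Icc_eq_integral_Ioc, ← intervalIntegral.integral_of_le pi_pos.le]
  have h : ∀ t : ℝ, sin ((a + 1 / 2) * t) * sin ((b + 1 / 2) * t) =
      1 / 2 * (cos (((a - b : ℤ) : ℝ) * t) - cos (((a + b + 1 : ℤ) : ℝ) * t)) := by
    intro t
    rw [show (((a - b : ℤ) : ℝ) * t) = (a + 1 / 2) * t - (b + 1 / 2) * t by push_cast; ring,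
      show (((a + b + 1 : ℤ) : ℝ) * t) = (a + 1 / 2) * t + (b + 1 / 2) * t by push_cast; ring,
      cos_sub, cos_add]
    ring
  simp only [h]
  rw [intervalIntegral.integral_const_mul, intervalIntegral.integral_sub
    (Continuous.intervalIntegrable (by fun_prop) _ _)
    (Continuous.intervalIntegrable (by fun_prop) _ _), integral_cos_int_mul, integral_cos_int_mul,
    if_neg (show ¬ ((a : ℤ) + b + 1 = 0) by omega)]
  by_cases hab : a = b
  · simp [hab]; ring
  · rw [if_neg hab, if_neg (by omega)]; simp

theorem densitySO_eq_det_sq {N : ℕ} (θ : Fin N → ℝ) :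
    densitySO N θ = 2 ^ N / (π ^ N * N.factorial) *
      (Matrix.of fun a i : Fin N => sin (((a : ℕ) + 1 / 2) * θ i)).det ^ 2 := by
  have h1 : (Matrix.of fun a i : Fin N => sin (((a : ℕ) + 1 / 2) * θ i)).det =
      (∏ i, sin (θ i / 2)) *
        ∏ i : Fin N, ∏ j ∈ Finset.Ioi i, (2 * cos (θ j) - 2 * cos (θ i)) := by
    rw [← det_vandermonde (fun j => 2 * cos (θ j)),
      det_eval_matrixOfPolynomials_eq_det_vandermonde _ (fun j : Fin N => chebW j)
        (fun j => (chebW_monic_natDegree j).2) (fun j => (chebW_monic_natDegree j).1),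
      ← det_mul_column, ← det_transpose]
    congr 1
    ext i j
    simp only [transpose_apply, of_apply]
    exact (sin_half_mul_eval_chebW _ _).symm
  have h2 : ∏ i : Fin N, ∏ j ∈ Finset.Ioi i, (2 * cos (θ j) - 2 * cos (θ i)) ^ 2 =
      2 ^ (N * (N - 1)) * ∏ i : Fin N, ∏ j ∈ Finset.Ioi i, (cos (θ j) - cos (θ i)) ^ 2 := by
    have : ∀ i : Fin N, ∏ j ∈ Finset.Ioi i, (2 * cos (θ j) - 2 * cos (θ i)) ^ 2 =
        4 ^ (N - 1 - i) * ∏ j ∈ Finset.Ioi i, (cos (θ j) - cos (θ i)) ^ 2 := by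
      intro i
      rw [← Fin.card_Ioi, ← Finset.prod_const, ← Finset.prod_mul_distrib]
      refine Finset.prod_congr rfl fun j _ => ?_
      ring
    simp only [this]
    rw [Finset.prod_mul_distrib]
    congr 1
    rw [Finset.prod_pow_eq_pow_sum, Fin.sum_univ_eq_sum_range (fun i => N - 1 - i),
      Finset.sum_range_reflect (fun i => i), show (4 : ℝ) = 2 ^ 2 by norm_num, ← pow_mul, mul_comm,
      Finset.sum_range_id_mul_two]
  rw [h1, densitySO, mul_pow, ← Finset.prod_pow, ← Finset.prod_pow]
  simp only [← Finset.prod_pow]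
  rw [h2]
  have h3 : (2 : ℝ) ^ (N ^ 2) = 2 ^ N * 2 ^ (N * (N - 1)) := by
    rw [← pow_add]
    congr 1
    rcases N with _ | n
    · rfl
    · rw [Nat.add_sub_cancel]; ring
  rw [h3]
  ring

theorem angleInt_one (N : ℕ) : angleInt N 1 = 1 := by
  rw [angleInt_apply]
  simp only [map_one, one_mul, densitySO_eq_det_sq]
  rw [integral_const_mul]
  have hcs : ∀ σ τ : Equiv.Perm (Fin N), ∫ θ in angleBox N,
      ∏ i, (sin (((σ i : ℕ) + 1 / 2) * θ i) * sin (((τ i : ℕ) + 1 / 2) * θ i)) =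
      if σ = τ then (π / 2) ^ N else 0 := by
    intro σ τ
    rw [volume_pi, Measure.restrict_pi_pi, integral_fintype_prod_eq_prod (f := fun i t =>
      sin (((σ i : ℕ) + 1 / 2) * t) * sin (((τ i : ℕ) + 1 / 2) * t))]
    simp only [integral_sin_mul_sin]
    split_ifs with h
    · simp [h, div_pow]
    · obtain ⟨i, hi⟩ : ∃ i, σ i ≠ τ i := by
        by_contra hne
        push Not at hne
        exact h (Equiv.ext hne)
      exact Finset.prod_eq_zero (Finset.mem_univ i) (if_neg fun h' => hi (Fin.ext h'))
  have hexp : ∀ θ : Fin N → ℝ,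
      (Matrix.of fun a i : Fin N => sin (((a : ℕ) + 1 / 2) * θ i)).det ^ 2 =
      ∑ σ : Equiv.Perm (Fin N), ∑ τ : Equiv.Perm (Fin N),
        ((Equiv.Perm.sign σ : ℤ) : ℝ) * ((Equiv.Perm.sign τ : ℤ) : ℝ) *
        ∏ i, (sin (((σ i : ℕ) + 1 / 2) * θ i) * sin (((τ i : ℕ) + 1 / 2) * θ i)) := by
    intro θ
    rw [det_apply', pow_two, Finset.sum_mul_sum]
    refine Finset.sum_congr rfl fun σ _ => Finset.sum_congr rfl fun τ _ => ?_
    rw [Finset.prod_mul_distrib]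
    simp only [of_apply]
    ring
  simp only [hexp]
  have hinteg : ∀ σ τ : Equiv.Perm (Fin N), IntegrableOn (fun θ : Fin N → ℝ =>
      ((Equiv.Perm.sign σ : ℤ) : ℝ) * ((Equiv.Perm.sign τ : ℤ) : ℝ) *
        ∏ i, (sin (((σ i : ℕ) + 1 / 2) * θ i) * sin (((τ i : ℕ) + 1 / 2) * θ i)))
      (angleBox N) := fun σ τ => integrableOn_angleBox (by fun_prop)
  rw [integral_finsetSum _ fun σ _ => integrable_finsetSum _ fun τ _ => hinteg σ τ]
  have hσ : ∀ σ : Equiv.Perm (Fin N), ∫ θ in angleBox N, ∑ τ : Equiv.Perm (Fin N),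
        ((Equiv.Perm.sign σ : ℤ) : ℝ) * ((Equiv.Perm.sign τ : ℤ) : ℝ) *
        ∏ i, (sin (((σ i : ℕ) + 1 / 2) * θ i) * sin (((τ i : ℕ) + 1 / 2) * θ i)) =
        (π / 2) ^ N := by
    intro σ
    rw [integral_finsetSum _ fun τ _ => hinteg σ τ]
    simp only [integral_const_mul, hcs, mul_ite, mul_zero, Finset.sum_ite_eq, Finset.mem_univ,
      if_true]
    have : ((Equiv.Perm.sign σ : ℤ) : ℝ) * ((Equiv.Perm.sign σ : ℤ) : ℝ) = 1 := by
      rw [← Int.cast_mul, ← Units.val_mul, Int.units_mul_self]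
      simp
    rw [this, one_mul]
  simp only [hσ, Finset.sum_const, Finset.card_univ, Fintype.card_perm, Fintype.card_fin,
    nsmul_eq_mul]
  have := pi_pos
  have : (N.factorial : ℝ) ≠ 0 := Nat.cast_ne_zero.mpr (Nat.factorial_ne_zero N)
  rw [div_pow]
  field_simp

end EigenanglePositivity

section LoopUniqueness

open MvPolynomial

theorem eq_C_of_pderiv_eq_zero {N : ℕ} {g : MvPolynomial (Fin N) ℝ} (h : ∀ j, pderiv j g = 0) :
    ∃ c, g = C c := by
  refine ⟨coeff 0 g, ?_⟩
  ext m
  rw [coeff_C]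
  split_ifs with hm
  · rw [hm]
  · obtain ⟨j, hj⟩ : ∃ j, m j ≠ 0 := by
      by_contra hne
      push Not at hne
      exact hm (Finsupp.ext fun j => (hne j).symm)
    have h1 := congrArg (coeff (m - Finsupp.single j 1)) (h j)
    rw [coeff_pderiv, coeff_zero, tsub_add_cancel_of_le
      (Finsupp.single_le_iff.mpr (Nat.one_le_iff_ne_zero.mpr hj))] at h1
    refine (mul_eq_zero.mp h1).resolve_right ?_
    positivity

/-- Positivity of the Dirichlet form: a symmetric polynomial with zero energy is constant. -/
theorem eq_C_of_energy_eq_zero {N M : ℕ} {P : MvPolynomial ℕ ℝ}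
    (hM : ∀ j : Fin N, pderiv j (psumHom N P) =
      ∑ k ∈ Finset.range M, psumHom N (gradCoeff k P) * X j ^ k)
    (h0 : ∑ k ∈ Finset.range M, angleInt N (psumHom N (gradCoeff k P) *
      fieldDer N k (psumHom N P)) = 0) : ∃ c, psumHom N P = C c := by
  have hsum : ∑ k ∈ Finset.range M, psumHom N (gradCoeff k P) * fieldDer N k (psumHom N P) =
      -∑ j, (4 - X j ^ 2) * pderiv j (psumHom N P) ^ 2 := by
    simp only [fieldDer_eq_sum_pderiv, Finset.mul_sum]
    rw [Finset.sum_comm, ← Finset.sum_neg_distrib]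
    refine Finset.sum_congr rfl fun j _ => ?_
    have : ∀ k, psumHom N (gradCoeff k P) * ((X j ^ (k + 2) - 4 * X j ^ k) *
        pderiv j (psumHom N P)) = (psumHom N (gradCoeff k P) * X j ^ k) *
        ((X j ^ 2 - 4) * pderiv j (psumHom N P)) := fun k => by ring
    simp only [this]
    rw [← Finset.sum_mul, ← hM j]
    ring
  rw [← map_sum, hsum, map_neg, neg_eq_zero, map_sum] at h0
  have hnn : ∀ (j : Fin N) (y : Fin N → ℝ), (∀ j, |y j| ≤ 2) →
      0 ≤ eval y ((4 - X j ^ 2) * pderiv j (psumHom N P) ^ 2) := by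
    intro j y hy
    simp only [map_mul, map_sub, map_pow, eval_X, map_ofNat]
    refine mul_nonneg ?_ (sq_nonneg _)
    nlinarith [abs_le.mp (hy j)]
  have hinteg : ∀ j : Fin N, 0 ≤ angleInt N ((4 - X j ^ 2) * pderiv j (psumHom N P) ^ 2) := by
    intro j
    rw [angleInt_apply]
    exact integral_nonneg fun θ => mul_nonneg (hnn j _ fun i => abs_two_mul_cos_le _)
      (densitySO_nonneg N θ)
  refine eq_C_of_pderiv_eq_zero fun j => ?_
  have hj := (Finset.sum_eq_zero_iff_of_nonneg fun j _ => hinteg j).mp h0 j (Finset.mem_univ j)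
  have hz := eq_zero_of_angleInt_eq_zero (hnn j) hj
  refine pow_eq_zero_iff (two_ne_zero) |>.mp ((mul_eq_zero.mp hz).resolve_left ?_)
  intro h
  have := congrArg (eval fun _ => (0 : ℝ)) h
  simp only [map_sub, map_pow, eval_X, map_ofNat, map_zero] at this
  norm_num at this

/-- Every functional on a finite-dimensional space of polynomials is represented by an element
of that space. -/
theorem exists_angleInt_mul_eq {N : ℕ} (V : Submodule ℝ (MvPolynomial (Fin N) ℝ))
    [FiniteDimensional ℝ V] (φ : V →ₗ[ℝ] ℝ) :
    ∃ g ∈ V, ∀ f : V, φ f = angleInt N (f * g) := by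
  let B : V →ₗ[ℝ] Module.Dual ℝ V := LinearMap.mk₂ ℝ
    (fun g f : V => angleInt N ((f : MvPolynomial (Fin N) ℝ) * g))
    (fun a b c => by simp only [Submodule.coe_add, mul_add, map_add])
    (fun c a b => by simp only [Submodule.coe_smul, mul_smul_comm, map_smul])
    (fun a b c => by simp only [Submodule.coe_add, add_mul, map_add])
    (fun c a b => by simp only [Submodule.coe_smul, smul_mul_assoc, map_smul])
  have hinj : Function.Injective B := by
    rw [← LinearMap.ker_eq_bot, LinearMap.ker_eq_bot']
    intro g hg
    have h1 : angleInt N ((g : MvPolynomial (Fin N) ℝ) * g) = 0 := LinearMap.congr_fun hg g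
    have h2 := eq_zero_of_angleInt_eq_zero (fun y _ => by
      rw [map_mul]; exact mul_self_nonneg _) h1
    exact Subtype.ext (mul_self_eq_zero.mp h2)
  have hsurj : Function.Surjective B :=
    (LinearMap.injective_iff_surjective_of_finrank_eq_finrank
      (Subspace.dual_finrank_eq (K := ℝ) (V := V)).symm).mp hinj
  obtain ⟨g, hg⟩ := hsurj φ
  exact ⟨g, g.2, fun f => (LinearMap.congr_fun hg f).symm⟩

/-- The loop equations determine the expectation of symmetric polynomials. -/
theorem eq_angleInt_of_loop {N : ℕ} (E : MvPolynomial ℕ ℝ →ₗ[ℝ] ℝ)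
    (hker : ∀ P, psumHom N P = 0 → E P = 0)
    (hloop : ∀ k F, E (loopDrift k * F + loopDer k F) = 0) (hone : E 1 = 1)
    (Q : MvPolynomial ℕ ℝ) : E Q = angleInt N (psumHom N Q) := by
  obtain ⟨d, hQ⟩ := exists_mem_weightLE Q
  have hmem : E ∈ LinearMap.range (psumHom N).toLinearMap.dualMap := by
    rw [LinearMap.range_dualMap_eq_dualAnnihilator_ker, Submodule.mem_dualAnnihilator]
    exact hker
  obtain ⟨E', hE'⟩ := hmem
  have hE : ∀ P, E P = E' (psumHom N P) := fun P => (LinearMap.congr_fun hE' P).symm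
  set V := (weightLE d).map (psumHom N).toLinearMap with hV
  obtain ⟨g, ⟨P, hP, rfl⟩, hg⟩ := exists_angleInt_mul_eq V ((E' - angleInt N).comp V.subtype)
  have hg' : ∀ R ∈ weightLE d, E R - angleInt N (psumHom N R) =
      angleInt N (psumHom N R * psumHom N P) := fun R hR => by
    rw [hE]
    exact hg ⟨psumHom N R, Submodule.mem_map_of_mem hR⟩
  obtain ⟨M, hM⟩ := exists_pderiv_psumHom N P
  have hDP := hg' _ (loop_gradCoeff_mem_weightLE M hP)
  have hL : ∀ k F, angleInt N (psumHom N (loopDrift k * F + loopDer k F)) = 0 := by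
    intro k F
    rw [map_add, map_mul, psumHom_loopDer]
    exact angleInt_loop N k _
  rw [map_sum, map_sum, map_sum, Finset.sum_congr rfl fun k _ => hloop k _,
    Finset.sum_congr rfl fun k _ => hL k _, Finset.sum_const_zero, sub_zero, Finset.sum_mul,
    map_sum] at hDP
  have hen : ∑ k ∈ Finset.range M, angleInt N (psumHom N (gradCoeff k P) *
      fieldDer N k (psumHom N P)) = 0 := by
    rw [← neg_eq_zero, hDP, ← Finset.sum_neg_distrib]
    refine Finset.sum_congr rfl fun k _ => ?_
    have h := angleInt_loop N k (psumHom N (gradCoeff k P) * psumHom N P)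
    rw [Derivation.leibniz, smul_eq_mul, smul_eq_mul] at h
    rw [← map_neg, ← sub_eq_zero, ← map_sub, ← neg_eq_zero, ← map_neg, ← h]
    congr 1
    rw [map_add, map_mul, psumHom_loopDer]
    ring
  obtain ⟨c, hc⟩ := eq_C_of_energy_eq_zero (hM M le_rfl) hen
  have h1 := hg' 1 (C_mem_weightLE 1 d)
  rw [hone, map_one, angleInt_one, sub_self, one_mul, hc, ← mul_one (C c), C_mul', map_smul,
    angleInt_one, smul_eq_mul, mul_one] at h1
  have h2 := hg' Q hQ
  rw [hc, ← h1, map_zero, mul_zero, map_zero] at h2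
  exact sub_eq_zero.mp h2

end LoopUniqueness

section OrthogonalGroup

instance matrixBorelSpace {m n : Type*} [Countable m] [Countable n] :
    BorelSpace (Matrix m n ℝ) :=
  inferInstanceAs (BorelSpace (m → n → ℝ))

theorem mat_mul {N : ℕ} (X Y : SOodd N) : mat (X * Y) = mat X * mat Y := rfl

theorem mat_mul_transpose {N : ℕ} (X : SOodd N) : mat X * (mat X)ᵀ = 1 :=
  (mem_orthogonalGroup_iff _ _).mp X.1.2

theorem mat_transpose_mul {N : ℕ} (X : SOodd N) : (mat X)ᵀ * mat X = 1 :=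
  (mem_orthogonalGroup_iff' _ _).mp X.1.2

theorem det_mat {N : ℕ} (X : SOodd N) : (mat X).det = 1 := X.2

/-- The element of `SO(2N+1)` with a given underlying matrix. -/
def ofMat {N : ℕ} (x : Matrix (Fin (2 * N + 1)) (Fin (2 * N + 1)) ℝ) (h : x * xᵀ = 1)
    (hd : x.det = 1) : SOodd N :=
  ⟨⟨x, (mem_orthogonalGroup_iff _ _).mpr h⟩, hd⟩

theorem continuous_mat {N : ℕ} : Continuous (mat : SOodd N → _) :=
  continuous_subtype_val.comp continuous_subtype_val

theorem isEmbedding_mat {N : ℕ} : Topology.IsEmbedding (mat : SOodd N → _) :=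
  Topology.IsEmbedding.subtypeVal.comp Topology.IsEmbedding.subtypeVal

theorem range_mat (N : ℕ) : Set.range (mat : SOodd N → _) = {x | x * xᵀ = 1 ∧ x.det = 1} := by
  ext x
  constructor
  · rintro ⟨X, rfl⟩
    exact ⟨mat_mul_transpose X, det_mat X⟩
  · rintro ⟨h, hd⟩
    exact ⟨ofMat x h hd, rfl⟩

theorem abs_mat_apply_le {N : ℕ} (X : SOodd N) (i j : Fin (2 * N + 1)) : |mat X i j| ≤ 1 := by
  have h := congrFun (congrFun (mat_mul_transpose X) i) i
  rw [mul_apply, one_apply_eq] at h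
  simp only [transpose_apply] at h
  rw [← sq_le_one_iff_abs_le_one, pow_two, ← h]
  exact Finset.single_le_sum (f := fun j => mat X i j * mat X i j)
    (fun j _ => mul_self_nonneg _) (Finset.mem_univ j)

instance compactSpace_SOodd (N : ℕ) : CompactSpace (SOodd N) := by
  refine ⟨isEmbedding_mat.isCompact_iff.mpr ?_⟩
  rw [Set.image_univ]
  have hb : IsCompact (Set.univ.pi fun _ : Fin (2 * N + 1) => Set.univ.pi fun _ :
      Fin (2 * N + 1) => Set.Icc (-1 : ℝ) 1) :=
    isCompact_univ_pi fun _ => isCompact_univ_pi fun _ => isCompact_Icc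
  refine hb.of_isClosed_subset ?_ ?_
  · rw [range_mat]
    exact (isClosed_eq (by fun_prop) continuous_const).inter
      (isClosed_eq (Continuous.matrix_det continuous_id) continuous_const)
  · rintro _ ⟨X, rfl⟩ i _ j _
    exact abs_le.mp (abs_mat_apply_le X i j)

end OrthogonalGroup

section OneParameter

open scoped Matrix.Norms.Operator

variable {N : ℕ}

/-- The one-parameter subgroup generated by a skew-symmetric matrix. -/
def rotFlow (A : Matrix (Fin (2 * N + 1)) (Fin (2 * N + 1)) ℝ) (hA : Aᵀ = -A) (t : ℝ) : SOodd N :=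
  have h : ∀ t : ℝ, NormedSpace.exp (t • A) * (NormedSpace.exp (t • A))ᵀ = 1 := fun t => by
    rw [← exp_transpose, transpose_smul, hA, smul_neg, ← exp_add_of_commute _ _
      (Commute.refl (t • A)).neg_right, add_neg_cancel, NormedSpace.exp_zero]
  ofMat (NormedSpace.exp (t • A)) (h t) (by
    have h2 : t • A = (t / 2) • A + (t / 2) • A := by rw [← add_smul, add_halves]
    have h3 := congrArg det (h (t / 2))
    rw [det_mul, det_transpose, det_one] at h3
    rw [h2, exp_add_of_commute _ _ (Commute.refl _), det_mul, h3])

theorem mat_rotFlow {A : Matrix (Fin (2 * N + 1)) (Fin (2 * N + 1)) ℝ} (hA : Aᵀ = -A) (t : ℝ) :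
    mat (rotFlow A hA t) = NormedSpace.exp (t • A) := rfl

theorem rotFlow_add {A : Matrix (Fin (2 * N + 1)) (Fin (2 * N + 1)) ℝ} (hA : Aᵀ = -A) (s t : ℝ) :
    rotFlow A hA (s + t) = rotFlow A hA s * rotFlow A hA t := by
  refine isEmbedding_mat.injective ?_
  rw [mat_mul, mat_rotFlow, mat_rotFlow, mat_rotFlow, add_smul, exp_add_of_commute]
  exact ((Commute.refl A).smul_left s).smul_right t

theorem rotFlow_zero {A : Matrix (Fin (2 * N + 1)) (Fin (2 * N + 1)) ℝ} (hA : Aᵀ = -A) :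
    rotFlow A hA 0 = 1 := by
  refine isEmbedding_mat.injective ?_
  rw [mat_rotFlow, zero_smul, NormedSpace.exp_zero]
  rfl

theorem hasDerivAt_mat_rotFlow_mul {A : Matrix (Fin (2 * N + 1)) (Fin (2 * N + 1)) ℝ}
    (hA : Aᵀ = -A) (X : SOodd N) :
    HasDerivAt (fun t => mat (rotFlow A hA t * X)) (A * mat X) 0 := by
  simp only [mat_mul, mat_rotFlow]
  have := (hasDerivAt_exp_smul_const (𝕂 := ℝ) A (0 : ℝ)).mul_const (mat X)
  rwa [zero_smul, NormedSpace.exp_zero, one_mul] at this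

theorem integrable_of_continuous_SOodd {μ : Measure (SOodd N)} [IsFiniteMeasure μ] {f : SOodd N → ℝ}
    (hf : Continuous f) : Integrable f μ := by
  obtain ⟨C, hC⟩ := (isCompact_range hf).isBounded.exists_norm_le
  exact Integrable.of_bound hf.aestronglyMeasurable C (ae_of_all _ fun X => hC _ ⟨X, rfl⟩)

/-- The integral of a Lie derivative over the group vanishes. -/
theorem integral_lieDeriv_eq_zero {μ : Measure (SOodd N)} [μ.IsMulLeftInvariant]
    [IsFiniteMeasure μ] {A : Matrix (Fin (2 * N + 1)) (Fin (2 * N + 1)) ℝ} (hA : Aᵀ = -A)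
    {f f' : SOodd N → ℝ} (hf : Continuous f) (hf' : Continuous f')
    (h : ∀ X, HasDerivAt (fun t => f (rotFlow A hA t * X)) (f' X) 0) : ∫ X, f' X ∂μ = 0 := by
  have h' : ∀ X u, HasDerivAt (fun t => f (rotFlow A hA t * X)) (f' (rotFlow A hA u * X)) u := by
    intro X u
    have h1 := h (rotFlow A hA u * X)
    rw [← sub_self u] at h1
    have h2 := h1.comp_sub_const u u
    refine h2.congr_of_eventuallyEq (Eventually.of_forall fun t => ?_)
    change _ = f (rotFlow A hA (t - u) * (rotFlow A hA u * X))
    rw [← mul_assoc, ← rotFlow_add, sub_add_cancel]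
  obtain ⟨C, hC⟩ := (isCompact_range hf').isBounded.exists_norm_le
  have hd := hasDerivAt_integral_of_dominated_loc_of_deriv_le (μ := μ) (x₀ := (0 : ℝ))
    (F := fun t X => f (rotFlow A hA t * X)) (F' := fun t X => f' (rotFlow A hA t * X))
    (bound := fun _ => C) Filter.univ_mem
    (Eventually.of_forall fun t =>
      (hf.comp (continuous_const.mul continuous_id)).aestronglyMeasurable)
    (integrable_of_continuous_SOodd (hf.comp (continuous_const.mul continuous_id)))
    (hf'.comp (continuous_const.mul continuous_id)).aestronglyMeasurable
    (ae_of_all _ fun X t _ => hC _ ⟨_, rfl⟩) (integrable_const C)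
    (ae_of_all _ fun X t _ => h' X t)
  have hd2 := hd.2
  simp only [rotFlow_zero, one_mul] at hd2
  have hc : (fun t => ∫ X, f (rotFlow A hA t * X) ∂μ) = fun _ => ∫ X, f X ∂μ :=
    funext fun t => integral_mul_left_eq_self f _
  rw [hc] at hd2
  exact hd2.unique (hasDerivAt_const _ _)

end OneParameter

section TraceIdentities

variable {n : ℕ}

/-- The elementary skew-symmetric matrix. -/
def skewUnit (i j : Fin n) : Matrix (Fin n) (Fin n) ℝ := single i j 1 - single j i 1

theorem transpose_skewUnit (i j : Fin n) : (skewUnit i j)ᵀ = -skewUnit i j := by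
  rw [skewUnit, transpose_sub, transpose_single, transpose_single, neg_sub]

theorem trace_mul_skewUnit (P : Matrix (Fin n) (Fin n) ℝ) (i j : Fin n) :
    (P * skewUnit i j).trace = P j i - P i j := by
  rw [skewUnit, mul_sub, trace_sub, trace_mul_single, trace_mul_single]
  simp

theorem trace_mul_transpose_eq_sum (P Q : Matrix (Fin n) (Fin n) ℝ) :
    (P * Qᵀ).trace = ∑ i, ∑ j, P i j * Q i j := by
  simp only [trace, diag_apply, mul_apply, transpose_apply]

theorem trace_mul_eq_sum (P Q : Matrix (Fin n) (Fin n) ℝ) :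
    (P * Q).trace = ∑ i, ∑ j, P i j * Q j i := by
  simp only [trace, diag_apply, mul_apply]

theorem sum_trace_mul_trace_skewUnit (P Q : Matrix (Fin n) (Fin n) ℝ) :
    ∑ i, ∑ j, (P * skewUnit i j).trace * (Q * skewUnit i j).trace =
      2 * (P * Qᵀ).trace - 2 * (P * Q).trace := by
  simp only [trace_mul_skewUnit, sub_mul, mul_sub, Finset.sum_sub_distrib]
  rw [trace_mul_transpose_eq_sum, trace_mul_eq_sum,
    Finset.sum_comm (f := fun i j => P j i * Q j i), Finset.sum_comm (f := fun i j => P j i * Q i j)]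
  ring

theorem sum_trace_skewUnit_skewUnit (P Q : Matrix (Fin n) (Fin n) ℝ) :
    ∑ i, ∑ j, (P * skewUnit i j * Q * skewUnit i j).trace =
      2 * (P * Qᵀ).trace - 2 * (P.trace * Q.trace) := by
  have h : ∀ i j k l : Fin n, (P * (single i j (1 : ℝ) * Q * single k l (1 : ℝ))).trace =
      Q j k * P l i := by
    intro i j k l
    rw [single_mul_mul_single, trace_mul_single]
    simp [mul_comm]
  have h2 : ∀ i j : Fin n, (P * skewUnit i j * Q * skewUnit i j).trace =
      Q j i * P j i - Q j j * P i i - Q i i * P j j + Q i j * P i j := by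
    intro i j
    rw [← h i j i j, ← h i j j i, ← h j i i j, ← h j i j i, ← trace_sub, ← trace_sub, ← trace_add]
    congr 1
    rw [skewUnit]
    noncomm_ring
  simp only [h2, Finset.sum_add_distrib, Finset.sum_sub_distrib]
  rw [Finset.sum_comm (f := fun i j => Q j i * P j i), trace_mul_transpose_eq_sum, trace, trace,
    Finset.sum_mul_sum, Finset.sum_comm (f := fun i j => Q j j * P i i)]
  have h3 : ∑ i, ∑ j, diag P i * diag Q j = ∑ i, ∑ j, Q i i * P j j := by
    rw [Finset.sum_comm]
    simp only [diag_apply, mul_comm]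
  simp only [h3, mul_comm (P _ _) (Q _ _)]
  ring

variable {X : Matrix (Fin n) (Fin n) ℝ}

theorem commute_add_transpose (h : X * Xᵀ = 1) (h' : Xᵀ * X = 1) : Commute X (X + Xᵀ) :=
  (Commute.refl X).add_right (h.trans h'.symm)

theorem commute_transpose_add_transpose (h : X * Xᵀ = 1) (h' : Xᵀ * X = 1) :
    Commute Xᵀ (X + Xᵀ) :=
  Commute.add_right (h'.trans h.symm) (Commute.refl Xᵀ)

theorem transpose_add_transpose_pow (k : ℕ) : ((X + Xᵀ) ^ k)ᵀ = (X + Xᵀ) ^ k := by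
  rw [transpose_pow, transpose_add, transpose_transpose, add_comm]

theorem transpose_sub_transpose : (X - Xᵀ)ᵀ = -(X - Xᵀ) := by
  rw [transpose_sub, transpose_transpose, neg_sub]

theorem commute_pow_sub_transpose (h : X * Xᵀ = 1) (h' : Xᵀ * X = 1) (k : ℕ) :
    Commute ((X + Xᵀ) ^ k) (X - Xᵀ) :=
  (((commute_add_transpose h h').sub_left (commute_transpose_add_transpose h h')).pow_right k).symm

theorem transpose_pow_mul_sub_transpose (h : X * Xᵀ = 1) (h' : Xᵀ * X = 1) (k : ℕ) :
    ((X + Xᵀ) ^ k * (X - Xᵀ))ᵀ = -((X + Xᵀ) ^ k * (X - Xᵀ)) := by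
  rw [transpose_mul, transpose_add_transpose_pow, transpose_sub_transpose, neg_mul,
    (commute_pow_sub_transpose h h' k).eq]

theorem trace_pow_mul_sub_transpose (h : X * Xᵀ = 1) (h' : Xᵀ * X = 1) (k : ℕ) :
    ((X + Xᵀ) ^ k * (X - Xᵀ)).trace = 0 := by
  have := congrArg trace (transpose_pow_mul_sub_transpose h h' k)
  rw [trace_transpose, trace_neg] at this
  linarith

theorem trace_pow_mul_sub_mul_sub (h : X * Xᵀ = 1) (h' : Xᵀ * X = 1) (k l : ℕ) :
    ((X + Xᵀ) ^ k * (X - Xᵀ) * ((X + Xᵀ) ^ l * (X - Xᵀ))).trace =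
      ((X + Xᵀ) ^ (k + l + 2)).trace - 4 * ((X + Xᵀ) ^ (k + l)).trace := by
  have h1 : (X - Xᵀ) * (X - Xᵀ) = (X + Xᵀ) ^ 2 - 4 • (1 : Matrix (Fin n) (Fin n) ℝ) := by
    rw [pow_two, sub_mul, mul_sub, mul_sub, add_mul, mul_add, mul_add, h, h']
    abel
  have h2 : (X + Xᵀ) ^ k * (X - Xᵀ) * ((X + Xᵀ) ^ l * (X - Xᵀ)) =
      (X + Xᵀ) ^ (k + l + 2) - 4 • (X + Xᵀ) ^ (k + l) := by
    rw [mul_assoc, ← mul_assoc (X - Xᵀ), ← (commute_pow_sub_transpose h h' l).eq, mul_assoc, h1,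
      mul_sub, mul_sub, ← pow_add, ← pow_add, mul_smul_comm, mul_smul_comm, mul_one, ← pow_add]
    rfl
  rw [h2, trace_sub, trace_smul]
  simp

theorem trace_pow_mul_mul_sub_transpose (h : X * Xᵀ = 1) (h' : Xᵀ * X = 1) (k : ℕ) :
    (X * (X + Xᵀ) ^ k * (X - Xᵀ)).trace =
      1 / 2 * (((X + Xᵀ) ^ (k + 2)).trace - 4 * ((X + Xᵀ) ^ k).trace) := by
  have h1 := trace_pow_mul_sub_mul_sub h h' 0 k
  rw [zero_add, pow_zero, one_mul, sub_mul, trace_sub] at h1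
  have h2 : (Xᵀ * ((X + Xᵀ) ^ k * (X - Xᵀ))).trace = -(X * ((X + Xᵀ) ^ k * (X - Xᵀ))).trace := by
    rw [← trace_transpose, transpose_mul, transpose_transpose, transpose_pow_mul_sub_transpose h h',
      neg_mul, trace_neg, trace_mul_comm]
  rw [mul_assoc]
  linarith

theorem trace_pow_mul_transpose (k : ℕ) :
    ((X + Xᵀ) ^ k * Xᵀ).trace = 1 / 2 * ((X + Xᵀ) ^ (k + 1)).trace := by
  have h2 : ((X + Xᵀ) ^ k * X).trace = ((X + Xᵀ) ^ k * Xᵀ).trace := by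
    rw [← trace_transpose, transpose_mul, transpose_add_transpose_pow, trace_mul_comm]
  rw [pow_succ, mul_add, trace_add, h2]
  ring

/-- The total divergence of the vector fields `tr (S ^ k M A)`. -/
theorem sum_trace_divergence (h : X * Xᵀ = 1) (h' : Xᵀ * X = 1) (k : ℕ) :
    ∑ i, ∑ j, ((∑ a ∈ Finset.range k, ((X + Xᵀ) ^ (k - 1 - a) *
        (skewUnit i j * X - Xᵀ * skewUnit i j) * (X + Xᵀ) ^ a * (X - Xᵀ) * skewUnit i j).trace) +
      ((X + Xᵀ) ^ k * (skewUnit i j * X + Xᵀ * skewUnit i j) * skewUnit i j).trace) =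
    -∑ a ∈ Finset.range k, ((X + Xᵀ) ^ (k - 1 - a)).trace *
        (((X + Xᵀ) ^ (a + 2)).trace - 4 * ((X + Xᵀ) ^ a).trace) +
      (2 - n) * ((X + Xᵀ) ^ (k + 1)).trace - ((X + Xᵀ) ^ k).trace * ((X + Xᵀ) ^ 1).trace := by
  have h1 : ∀ a c, ∑ i, ∑ j, ((X + Xᵀ) ^ c * (skewUnit i j * X - Xᵀ * skewUnit i j) *
      (X + Xᵀ) ^ a * (X - Xᵀ) * skewUnit i j).trace =
      -(((X + Xᵀ) ^ c).trace * (((X + Xᵀ) ^ (a + 2)).trace - 4 * ((X + Xᵀ) ^ a).trace)) := by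
    intro a c
    have e1 : ∀ A, (X + Xᵀ) ^ c * (A * X - Xᵀ * A) * (X + Xᵀ) ^ a * (X - Xᵀ) * A =
        (X + Xᵀ) ^ c * A * (X * (X + Xᵀ) ^ a * (X - Xᵀ)) * A -
          (X + Xᵀ) ^ c * Xᵀ * A * ((X + Xᵀ) ^ a * (X - Xᵀ)) * A := by
      intro A
      simp only [mul_sub, sub_mul, mul_assoc]
      abel
    simp only [e1, trace_sub, Finset.sum_sub_distrib]
    rw [sum_trace_skewUnit_skewUnit, sum_trace_skewUnit_skewUnit, trace_pow_mul_sub_transpose h h',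
      trace_pow_mul_mul_sub_transpose h h', mul_assoc X, transpose_mul,
      transpose_pow_mul_sub_transpose h h']
    have e2 : (X + Xᵀ) ^ c * (-((X + Xᵀ) ^ a * (X - Xᵀ)) * Xᵀ) =
        (X + Xᵀ) ^ c * Xᵀ * -((X + Xᵀ) ^ a * (X - Xᵀ)) := by
      have hc : Commute ((X + Xᵀ) ^ a * (X - Xᵀ)) Xᵀ :=
        (((commute_transpose_add_transpose h h').pow_right a).mul_right
          ((show Commute Xᵀ X from h'.trans h.symm).sub_right (Commute.refl _))).symm
      rw [mul_assoc, hc.neg_left.eq]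
    rw [e2]
    ring
  have h2 : ∑ i, ∑ j, ((X + Xᵀ) ^ k * (skewUnit i j * X + Xᵀ * skewUnit i j) *
      skewUnit i j).trace = (2 - n) * ((X + Xᵀ) ^ (k + 1)).trace -
        ((X + Xᵀ) ^ k).trace * ((X + Xᵀ) ^ 1).trace := by
    have e1 : ∀ A, (X + Xᵀ) ^ k * (A * X + Xᵀ * A) * A =
        (X + Xᵀ) ^ k * A * X * A + (X + Xᵀ) ^ k * Xᵀ * A * 1 * A := by
      intro A
      simp only [mul_add, add_mul, mul_assoc, one_mul]
    simp only [e1, trace_add, Finset.sum_add_distrib]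
    rw [sum_trace_skewUnit_skewUnit, sum_trace_skewUnit_skewUnit, transpose_one, mul_one,
      trace_pow_mul_transpose, trace_one, Fintype.card_fin, pow_one, trace_add, trace_transpose]
    ring
  simp only [Finset.sum_add_distrib]
  rw [h2, ← Finset.sum_neg_distrib]
  have e3 : ∀ i, ∑ j, ∑ a ∈ Finset.range k, ((X + Xᵀ) ^ (k - 1 - a) *
      (skewUnit i j * X - Xᵀ * skewUnit i j) * (X + Xᵀ) ^ a * (X - Xᵀ) * skewUnit i j).trace =
      ∑ a ∈ Finset.range k, ∑ j, ((X + Xᵀ) ^ (k - 1 - a) *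
      (skewUnit i j * X - Xᵀ * skewUnit i j) * (X + Xᵀ) ^ a * (X - Xᵀ) * skewUnit i j).trace :=
    fun i => Finset.sum_comm
  rw [Finset.sum_congr rfl fun i _ => e3 i, Finset.sum_comm, Finset.sum_congr rfl fun a _ => h1 a _]
  ring

/-- The divergence in terms of the loop drift. -/
theorem loopDrift_eval_eq (q τ : ℕ → ℝ) (hq : ∀ l, q l = 2 ^ l + 2 * τ l) (k : ℕ) :
    -∑ a ∈ Finset.range k, q (k - 1 - a) * (q (a + 2) - 4 * q a) +
      (2 - q 0) * q (k + 1) - q k * q 1 = -4 * MvPolynomial.eval τ (loopDrift k) := by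
  have e0 : ∑ a ∈ Finset.range k, q (k - 1 - a) * (q (a + 2) - 4 * q a) =
      ∑ i ∈ Finset.range k, (2 * (2 ^ i * (τ (k + 1 - i) - 4 * τ (k - 1 - i))) +
        4 * (τ i * τ (k + 1 - i)) - 16 * (τ i * τ (k - 1 - i))) := by
    rw [← Finset.sum_range_reflect]
    refine Finset.sum_congr rfl fun i hi => ?_
    have hi' := Finset.mem_range.mp hi
    rw [show k - 1 - (k - 1 - i) = i by omega, show k - 1 - i + 2 = k + 1 - i by omega, hq, hq, hq]
    rw [show k + 1 - i = k - 1 - i + 2 by omega, pow_add]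
    ring
  have e1 : ∑ i ∈ Finset.range k, (2 : ℝ) ^ i * (τ (k + 1 - i) - 4 * τ (k - 1 - i)) =
      τ (k + 1) + 2 * τ k - 2 ^ k * τ 1 - 2 ^ (k + 1) * τ 0 := by
    have := Finset.sum_range_sub' (fun i => (2 : ℝ) ^ i * τ (k + 1 - i) + 2 ^ (i + 1) * τ (k - i)) k
    simp only [Nat.sub_zero, pow_zero, Nat.add_sub_cancel_left, Nat.sub_self, zero_add, pow_one,
      one_mul] at this
    rw [sub_sub, ← this]
    refine Finset.sum_congr rfl fun i hi => ?_
    have hi' := Finset.mem_range.mp hi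
    rw [show k + 1 - (i + 1) = k - i by omega, show k - (i + 1) = k - 1 - i by omega, pow_succ,
      pow_succ]
    ring
  simp only [loopDrift, map_add, map_sub, map_mul, map_sum, MvPolynomial.eval_X, map_ofNat]
  rw [Finset.sum_range_succ, Finset.sum_range_succ, Nat.sub_self, Nat.add_sub_cancel_left, e0,
    Finset.sum_sub_distrib, Finset.sum_add_distrib, ← Finset.mul_sum, ← Finset.mul_sum,
    ← Finset.mul_sum, e1, hq, hq, hq, hq]
  ring

end TraceIdentities

section GroupLoop

open scoped Matrix.Norms.Operator
open MvPolynomial (eval mkDerivation)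

theorem HasDerivAt.matrixTrace {n : ℕ} {f : ℝ → Matrix (Fin n) (Fin n) ℝ}
    {f' : Matrix (Fin n) (Fin n) ℝ} {t : ℝ} (h : HasDerivAt f f' t) :
    HasDerivAt (fun u => (f u).trace) f'.trace t :=
  (LinearMap.toContinuousLinearMap (traceLinearMap (Fin n) ℝ ℝ)).hasFDerivAt.comp_hasDerivAt t h

theorem HasDerivAt.matrixTranspose {n : ℕ} {f : ℝ → Matrix (Fin n) (Fin n) ℝ}
    {f' : Matrix (Fin n) (Fin n) ℝ} {t : ℝ} (h : HasDerivAt f f' t) :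
    HasDerivAt (fun u => (f u)ᵀ) f'ᵀ t :=
  (LinearMap.toContinuousLinearMap
    (transposeLinearEquiv (Fin n) (Fin n) ℝ ℝ).toLinearMap).hasFDerivAt.comp_hasDerivAt t h

variable {N : ℕ}

/-- The power sums of the values `2 cos θ_j` at the eigenangles, read off from traces. -/
def traceSum (X : SOodd N) (l : ℕ) : ℝ := (((mat X + (mat X)ᵀ) ^ l).trace - 2 ^ l) / 2

theorem continuous_traceSum (l : ℕ) : Continuous fun X : SOodd N => traceSum X l := by
  have h := continuous_mat (N := N)
  unfold traceSum
  fun_prop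

theorem continuous_eval_traceSum (F : MvPolynomial ℕ ℝ) :
    Continuous fun X : SOodd N => eval (traceSum X) F :=
  (MvPolynomial.continuous_eval F).comp (continuous_pi continuous_traceSum)

theorem exists_traceSum_eq (X : SOodd N) : ∃ y : Fin N → ℝ, (∀ j, |y j| ≤ 2) ∧
    (∀ s, charPoly X s = (1 - s) * ∏ j, (1 + s ^ 2 - s * y j)) ∧
    ∀ l, traceSum X l = ∑ j, y j ^ l := by
  obtain ⟨y, h1, h2, h3⟩ := exists_eigenvalue_param (mat_mul_transpose X) (det_mat X)
  refine ⟨y, h1, h2, fun l => ?_⟩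
  rw [traceSum, h3]
  ring

theorem eval_traceSum {X : SOodd N} {y : Fin N → ℝ} (hy : ∀ l, traceSum X l = ∑ j, y j ^ l)
    (P : MvPolynomial ℕ ℝ) : eval (traceSum X) P = eval y (psumHom N P) := by
  have h : (eval (traceSum X) : MvPolynomial ℕ ℝ →+* ℝ) =
      (eval y).comp (psumHom N : MvPolynomial ℕ ℝ →+* MvPolynomial (Fin N) ℝ) := by
    ext l
    · simp
    · simp [psumHom, hy, MvPolynomial.psum]
  exact congrFun (congrArg DFunLike.coe h) P

/-- The derivative of `traceSum` in the direction `A`. -/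
def lieCoeff (A : Matrix (Fin (2 * N + 1)) (Fin (2 * N + 1)) ℝ) (X : SOodd N) (l : ℕ) : ℝ :=
  l * ((mat X + (mat X)ᵀ) ^ (l - 1) * (mat X - (mat X)ᵀ) * A).trace / 2

/-- The derivative of a polynomial in `traceSum` in the direction `A`. -/
def lieEval (A : Matrix (Fin (2 * N + 1)) (Fin (2 * N + 1)) ℝ) (F : MvPolynomial ℕ ℝ)
    (X : SOodd N) : ℝ :=
  eval (traceSum X) (mkDerivation ℝ (fun l => MvPolynomial.C (lieCoeff A X l)) F)

variable {A : Matrix (Fin (2 * N + 1)) (Fin (2 * N + 1)) ℝ}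

theorem lieEval_C (a : ℝ) (X : SOodd N) : lieEval A (MvPolynomial.C a) X = 0 := by
  simp [lieEval]

theorem lieEval_add (F G : MvPolynomial ℕ ℝ) (X : SOodd N) :
    lieEval A (F + G) X = lieEval A F X + lieEval A G X := by
  simp [lieEval]

theorem lieEval_mul_X (F : MvPolynomial ℕ ℝ) (l : ℕ) (X : SOodd N) :
    lieEval A (F * MvPolynomial.X l) X =
      eval (traceSum X) F * lieCoeff A X l + traceSum X l * lieEval A F X := by
  simp [lieEval, Derivation.leibniz]

theorem continuous_lieCoeff (l : ℕ) : Continuous fun X : SOodd N => lieCoeff A X l := by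
  have h := continuous_mat (N := N)
  unfold lieCoeff
  fun_prop

theorem continuous_lieEval (F : MvPolynomial ℕ ℝ) : Continuous (lieEval (N := N) A F) := by
  induction F using MvPolynomial.induction_on with
  | C a =>
    rw [funext (lieEval_C a)]
    exact continuous_const
  | add F G hF hG =>
    rw [funext (lieEval_add F G)]
    exact hF.add hG
  | mul_X F l hF =>
    rw [funext (lieEval_mul_X F l)]
    exact ((continuous_eval_traceSum F).mul (continuous_lieCoeff l)).add
      ((continuous_traceSum l).mul hF)

variable (hA : Aᵀ = -A) (X : SOodd N)

theorem hasDerivAt_transpose_rotFlow_mul :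
    HasDerivAt (fun t => (mat (rotFlow A hA t * X))ᵀ) (-((mat X)ᵀ * A)) 0 :=
  (hasDerivAt_mat_rotFlow_mul hA X).matrixTranspose.congr_deriv (by
    rw [transpose_mul, hA, mul_neg])

theorem hasDerivAt_pow_add_transpose (k : ℕ) :
    HasDerivAt (fun t => (mat (rotFlow A hA t * X) + (mat (rotFlow A hA t * X))ᵀ) ^ k)
      (∑ a ∈ Finset.range k, (mat X + (mat X)ᵀ) ^ (k - 1 - a) * (A * mat X - (mat X)ᵀ * A) *
        (mat X + (mat X)ᵀ) ^ a) 0 := by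
  refine (((hasDerivAt_mat_rotFlow_mul hA X).add
    (hasDerivAt_transpose_rotFlow_mul hA X)).fun_pow' k).congr_deriv ?_
  simp only [Pi.add_apply, rotFlow_zero, one_mul, Nat.pred_eq_sub_one, ← sub_eq_add_neg]

theorem hasDerivAt_traceSum (l : ℕ) :
    HasDerivAt (fun t => traceSum (rotFlow A hA t * X) l) (lieCoeff A X l) 0 := by
  refine (((hasDerivAt_pow_add_transpose hA X l).matrixTrace.sub_const (2 ^ l)).div_const
    2).congr_deriv ?_
  have h := mat_mul_transpose X
  have h' := mat_transpose_mul X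
  rw [lieCoeff, trace_sum]
  congr 1
  have key : ∀ a ∈ Finset.range l, ((mat X + (mat X)ᵀ) ^ (l - 1 - a) *
      (A * mat X - (mat X)ᵀ * A) * (mat X + (mat X)ᵀ) ^ a).trace =
      ((mat X + (mat X)ᵀ) ^ (l - 1) * (mat X - (mat X)ᵀ) * A).trace := by
    intro a ha
    have hl : a + (l - 1 - a) = l - 1 := by
      have := Finset.mem_range.mp ha
      omega
    have hc := (commute_add_transpose h h').pow_right (l - 1)
    rw [trace_mul_comm, ← mul_assoc, ← pow_add, hl, mul_sub, trace_sub, mul_sub, sub_mul,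
      trace_sub, ← mul_assoc, ← mul_assoc, trace_mul_comm _ (mat X), ← mul_assoc, hc.eq]
  rw [Finset.sum_congr rfl key, Finset.sum_const, Finset.card_range, nsmul_eq_mul]

theorem hasDerivAt_eval_traceSum (F : MvPolynomial ℕ ℝ) :
    HasDerivAt (fun t => eval (traceSum (rotFlow A hA t * X)) F) (lieEval A F X) 0 := by
  induction F using MvPolynomial.induction_on with
  | C a =>
    simp only [lieEval_C, MvPolynomial.eval_C]
    exact hasDerivAt_const _ _
  | add F G hF hG =>
    simp only [lieEval_add, map_add]
    exact hF.add hG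
  | mul_X F l hF =>
    simp only [lieEval_mul_X, map_mul, MvPolynomial.eval_X]
    refine (hF.mul (hasDerivAt_traceSum hA X l)).congr_deriv ?_
    simp only [rotFlow_zero, one_mul]
    ring

theorem hasDerivAt_trace_pow_mul_sub (k : ℕ) :
    HasDerivAt (fun t => ((mat (rotFlow A hA t * X) + (mat (rotFlow A hA t * X))ᵀ) ^ k *
        (mat (rotFlow A hA t * X) - (mat (rotFlow A hA t * X))ᵀ) * A).trace)
      ((∑ a ∈ Finset.range k, ((mat X + (mat X)ᵀ) ^ (k - 1 - a) * (A * mat X - (mat X)ᵀ * A) *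
        (mat X + (mat X)ᵀ) ^ a * (mat X - (mat X)ᵀ) * A).trace) +
        ((mat X + (mat X)ᵀ) ^ k * (A * mat X + (mat X)ᵀ * A) * A).trace) 0 := by
  refine ((((hasDerivAt_pow_add_transpose hA X k).mul ((hasDerivAt_mat_rotFlow_mul hA X).sub
    (hasDerivAt_transpose_rotFlow_mul hA X))).mul_const A).matrixTrace).congr_deriv ?_
  simp only [Pi.sub_apply, rotFlow_zero, one_mul, sub_neg_eq_add, add_mul, trace_add,
    Finset.sum_mul, trace_sum]

theorem sum_trace_mul_lieEval (k : ℕ) (F : MvPolynomial ℕ ℝ) :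
    ∑ i, ∑ j, ((mat X + (mat X)ᵀ) ^ k * (mat X - (mat X)ᵀ) * skewUnit i j).trace *
      lieEval (skewUnit i j) F X = -4 * eval (traceSum X) (loopDer k F) := by
  have h := mat_mul_transpose X
  have h' := mat_transpose_mul X
  induction F using MvPolynomial.induction_on with
  | C a => simp [lieEval_C]
  | add F G hF hG =>
    simp only [lieEval_add, mul_add, Finset.sum_add_distrib, hF, hG, map_add]
  | mul_X F l hF =>
    have hgen : ∑ i, ∑ j, ((mat X + (mat X)ᵀ) ^ k * (mat X - (mat X)ᵀ) * skewUnit i j).trace *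
        lieCoeff (skewUnit i j) X l =
        -4 * eval (traceSum X) (loopDer k (MvPolynomial.X l)) := by
      have h1 := sum_trace_mul_trace_skewUnit ((mat X + (mat X)ᵀ) ^ k * (mat X - (mat X)ᵀ))
        ((mat X + (mat X)ᵀ) ^ (l - 1) * (mat X - (mat X)ᵀ))
      rw [transpose_pow_mul_sub_transpose h h', mul_neg, trace_neg,
        trace_pow_mul_sub_mul_sub h h'] at h1
      rw [loopDer, MvPolynomial.mkDerivation_X]
      rcases Nat.eq_zero_or_pos l with rfl | hl
      · simp [lieCoeff]
      · obtain ⟨l, rfl⟩ : ∃ r, l = r + 1 := ⟨l - 1, by omega⟩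
        rw [Nat.add_sub_cancel] at h1
        simp only [lieCoeff, Nat.add_sub_cancel, mul_div_assoc, mul_left_comm _ ((l + 1 : ℕ) : ℝ),
          ← Finset.mul_sum]
        simp only [← mul_div_assoc, ← Finset.sum_div, h1]
        simp [traceSum, ← add_assoc]
        ring
    simp only [lieEval_mul_X, mul_add, Finset.sum_add_distrib, mul_left_comm _ (eval _ _),
      mul_left_comm _ (traceSum X l), ← Finset.mul_sum, hF, hgen]
    simp [Derivation.leibniz]
    ring

variable {μ : Measure (SOodd N)} [μ.IsMulLeftInvariant]

theorem integral_loop [IsFiniteMeasure μ] (k : ℕ) (F : MvPolynomial ℕ ℝ) :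
    ∫ X, eval (traceSum X) (loopDrift k * F + loopDer k F) ∂μ = 0 := by
  have hm := continuous_mat (N := N)
  set g' : Fin (2 * N + 1) → Fin (2 * N + 1) → SOodd N → ℝ := fun i j X =>
    ((∑ a ∈ Finset.range k, ((mat X + (mat X)ᵀ) ^ (k - 1 - a) *
        (skewUnit i j * mat X - (mat X)ᵀ * skewUnit i j) *
        (mat X + (mat X)ᵀ) ^ a * (mat X - (mat X)ᵀ) * skewUnit i j).trace) +
        ((mat X + (mat X)ᵀ) ^ k * (skewUnit i j * mat X + (mat X)ᵀ * skewUnit i j) *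
          skewUnit i j).trace) * eval (traceSum X) F +
      ((mat X + (mat X)ᵀ) ^ k * (mat X - (mat X)ᵀ) * skewUnit i j).trace *
        lieEval (skewUnit i j) F X with hg'
  have hcont : ∀ i j, Continuous (g' i j) := fun i j => by
    have h1 := continuous_eval_traceSum (N := N) F
    have h2 := continuous_lieEval (N := N) (A := skewUnit i j) F
    simp only [hg']
    fun_prop
  have hzero : ∀ i j, ∫ X, g' i j X ∂μ = 0 := fun i j => by
    refine integral_lieDeriv_eq_zero (transpose_skewUnit i j) (f := fun X =>
      ((mat X + (mat X)ᵀ) ^ k * (mat X - (mat X)ᵀ) * skewUnit i j).trace *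
        eval (traceSum X) F) ?_ (hcont i j) fun X => ?_
    · have h1 := continuous_eval_traceSum (N := N) F
      fun_prop
    · refine ((hasDerivAt_trace_pow_mul_sub (transpose_skewUnit i j) X k).mul
        (hasDerivAt_eval_traceSum (transpose_skewUnit i j) X F)).congr_deriv ?_
      simp only [rotFlow_zero, one_mul, hg']
  have hsum : ∀ X : SOodd N, ∑ i, ∑ j, g' i j X =
      -4 * eval (traceSum X) (loopDrift k * F + loopDer k F) := fun X => by
    have h := mat_mul_transpose X
    have h' := mat_transpose_mul X
    have hd := loopDrift_eval_eq (fun l => ((mat X + (mat X)ᵀ) ^ l).trace) (traceSum X)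
      (fun l => by rw [traceSum]; ring) k
    have h0 : ((mat X + (mat X)ᵀ) ^ 0).trace = ((2 * N + 1 : ℕ) : ℝ) := by
      rw [pow_zero, trace_one, Fintype.card_fin]
    simp only [hg', Finset.sum_add_distrib, ← Finset.sum_mul]
    simp only [← Finset.sum_add_distrib]
    rw [sum_trace_divergence h h', sum_trace_mul_lieEval, ← h0, hd, map_add, map_mul]
    ring
  have hinteg : ∫ X, ∑ i, ∑ j, g' i j X ∂μ = 0 := by
    rw [integral_finsetSum _ fun i _ => integrable_of_continuous_SOodd
      (continuous_finsetSum _ fun j _ => hcont i j)]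
    refine Finset.sum_eq_zero fun i _ => ?_
    rw [integral_finsetSum _ fun j _ => integrable_of_continuous_SOodd (hcont i j)]
    exact Finset.sum_eq_zero fun j _ => hzero i j
  simp only [hsum, integral_const_mul] at hinteg
  linarith

/-- **Weyl integration formula** for `SO(2N+1)`, for polynomials in power sums. -/
theorem integral_eval_traceSum [IsProbabilityMeasure μ] (Q : MvPolynomial ℕ ℝ) :
    ∫ X, eval (traceSum X) Q ∂μ = angleInt N (psumHom N Q) := by
  have hi : ∀ P, Integrable (fun X : SOodd N => eval (traceSum X) P) μ := fun P =>
    integrable_of_continuous_SOodd (continuous_eval_traceSum P)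
  let E : MvPolynomial ℕ ℝ →ₗ[ℝ] ℝ :=
    { toFun := fun P => ∫ X, eval (traceSum X) P ∂μ
      map_add' := fun P R => by
        simp only [map_add]
        exact integral_add (hi P) (hi R)
      map_smul' := fun c P => by
        simp only [MvPolynomial.smul_eval, RingHom.id_apply, smul_eq_mul]
        exact integral_const_mul _ _ }
  refine eq_angleInt_of_loop E (fun P hP => ?_) integral_loop ?_ Q
  · refine integral_eq_zero_of_ae (ae_of_all _ fun X => ?_)
    obtain ⟨y, -, -, hy⟩ := exists_traceSum_eq X
    change eval (traceSum X) P = 0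
    rw [eval_traceSum hy, hP, map_zero]
  · change ∫ X, eval (traceSum X) 1 ∂μ = 1
    simp

end GroupLoop

section LinearStatistics

open Polynomial (eval)

variable {N : ℕ}

/-- The linear form in power sums attached to a one-variable polynomial. -/
def powerSumForm (r : Polynomial ℝ) : MvPolynomial ℕ ℝ :=
  r.sum fun l a => MvPolynomial.C a * MvPolynomial.X l

theorem eval_psumHom_powerSumForm (r : Polynomial ℝ) (y : Fin N → ℝ) :
    MvPolynomial.eval y (psumHom N (powerSumForm r)) = ∑ j, r.eval (y j) := by
  simp only [powerSumForm, Polynomial.sum, Polynomial.eval_eq_sum, map_sum, map_mul, psumHom,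
    MvPolynomial.aeval_X, MvPolynomial.psum, map_pow, MvPolynomial.eval_X]
  rw [Finset.sum_comm]
  refine Finset.sum_congr rfl fun l _ => ?_
  simp [Finset.mul_sum]

/-- Moments of linear eigenvalue statistics over `SO(2N+1)` are integrals against the joint
eigenangle density. -/
theorem integral_linearStatistic_pow {μ : Measure (SOodd N)} [μ.IsMulLeftInvariant]
    [IsProbabilityMeasure μ] {ψ : ℝ → ℝ} (hψ : ContinuousOn ψ (Set.Icc (-2) 2))
    {W : SOodd N → ℝ} (hW : ∀ X, ∃ y : Fin N → ℝ, (∀ j, |y j| ≤ 2) ∧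
      (∀ l, traceSum X l = ∑ j, y j ^ l) ∧ W X = ∑ j, ψ (y j)) :
    Continuous W ∧ ∀ n : ℕ, ∫ X, W X ^ n ∂μ =
      ∫ θ in angleBox N, (∑ j, ψ (2 * cos (θ j))) ^ n * densitySO N θ := by
  have happ : ∀ k : ℕ, ∃ r : Polynomial ℝ, ∀ x ∈ Set.Icc (-2 : ℝ) 2,
      |r.eval x - ψ x| < 1 / ((k : ℝ) + 1) := fun k =>
    exists_polynomial_near_of_continuousOn (-2) 2 ψ hψ _ Nat.one_div_pos_of_nat
  choose r hr using happ
  obtain ⟨B, hB⟩ := isCompact_Icc.exists_bound_of_continuousOn hψ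
  have hlim : Tendsto (fun k : ℕ => (N : ℝ) * (1 / ((k : ℝ) + 1))) atTop (nhds 0) := by
    simpa using tendsto_one_div_add_atTop_nhds_zero_nat.const_mul (N : ℝ)
  have hclose : ∀ k (y : Fin N → ℝ), (∀ j, |y j| ≤ 2) →
      |∑ j, (r k).eval (y j) - ∑ j, ψ (y j)| ≤ N * (1 / ((k : ℝ) + 1)) := by
    intro k y hy
    rw [← Finset.sum_sub_distrib]
    refine (Finset.abs_sum_le_sum_abs _ _).trans ?_
    refine (Finset.sum_le_sum fun j _ => (hr k _ (abs_le.mp (hy j))).le).trans ?_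
    simp
  have hbound : ∀ k (y : Fin N → ℝ), (∀ j, |y j| ≤ 2) →
      |∑ j, (r k).eval (y j)| ≤ N * (B + 1) := by
    intro k y hy
    refine (Finset.abs_sum_le_sum_abs _ _).trans ?_
    have : ∀ j ∈ Finset.univ, |(r k).eval (y j)| ≤ B + 1 := by
      intro j _
      have h1 := (hr k _ (abs_le.mp (hy j))).le
      have h2 := hB _ (abs_le.mp (hy j))
      have h3 : 1 / ((k : ℝ) + 1) ≤ 1 := by
        rw [div_le_one (by positivity)]
        linarith [(Nat.cast_nonneg k : (0 : ℝ) ≤ k)]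
      rw [Real.norm_eq_abs] at h2
      have h4 := abs_sub_abs_le_abs_sub ((r k).eval (y j)) (ψ (y j))
      linarith
    refine (Finset.sum_le_sum this).trans_eq ?_
    rw [Finset.sum_const, Finset.card_univ, Fintype.card_fin, nsmul_eq_mul]
  have hpoint : ∀ y : Fin N → ℝ, (∀ j, |y j| ≤ 2) →
      Tendsto (fun k => ∑ j, (r k).eval (y j)) atTop (nhds (∑ j, ψ (y j))) := fun y hy =>
    tendsto_iff_norm_sub_tendsto_zero.mpr
      (squeeze_zero (fun _ => norm_nonneg _) (fun k => hclose k y hy) hlim)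
  have hF : ∀ k (X : SOodd N) (y : Fin N → ℝ), (∀ l, traceSum X l = ∑ j, y j ^ l) →
      MvPolynomial.eval (traceSum X) (powerSumForm (r k)) = ∑ j, (r k).eval (y j) :=
    fun k X y hy => by rw [eval_traceSum hy, eval_psumHom_powerSumForm]
  refine ⟨?_, fun n => ?_⟩
  · have hu : TendstoUniformly
        (fun k X => MvPolynomial.eval (traceSum X) (powerSumForm (r k))) W atTop := by
      rw [Metric.tendstoUniformly_iff]
      intro ε hε
      filter_upwards [hlim.eventually_lt_const hε] with k hk X
      obtain ⟨y, hy2, hy, hWy⟩ := hW X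
      rw [hF k X y hy, hWy, dist_comm, Real.dist_eq]
      exact (hclose k y hy2).trans_lt hk
    exact hu.continuous (Frequently.of_forall fun k => continuous_eval_traceSum _)
  · have hgroup : Tendsto
        (fun k => ∫ X, MvPolynomial.eval (traceSum X) (powerSumForm (r k) ^ n) ∂μ) atTop
        (nhds (∫ X, W X ^ n ∂μ)) := by
      refine tendsto_integral_of_dominated_convergence (fun _ => (N * (B + 1)) ^ n)
        (fun k => (continuous_eval_traceSum _).aestronglyMeasurable) (integrable_const _)
        (fun k => ae_of_all _ fun X => ?_) (ae_of_all _ fun X => ?_)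
      all_goals obtain ⟨y, hy2, hy, hWy⟩ := hW X
      · rw [map_pow, hF k X y hy, norm_pow]
        exact pow_le_pow_left₀ (norm_nonneg _) (hbound k y hy2) n
      · simp only [map_pow, fun k => hF k X y hy, hWy]
        exact (hpoint y hy2).pow n
    have hcos : ∀ (θ : Fin N → ℝ) j, |2 * cos (θ j)| ≤ 2 := fun θ j => abs_two_mul_cos_le _
    have hangle : Tendsto (fun k => angleInt N (psumHom N (powerSumForm (r k) ^ n))) atTop
        (nhds (∫ θ in angleBox N, (∑ j, ψ (2 * cos (θ j))) ^ n * densitySO N θ)) := by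
      have hdens : Continuous (densitySO N) := by
        unfold densitySO
        fun_prop
      simp only [angleInt_apply, map_pow, eval_psumHom_powerSumForm]
      refine tendsto_integral_of_dominated_convergence
        (fun θ => (N * (B + 1)) ^ n * densitySO N θ)
        (fun k => (Continuous.aestronglyMeasurable (by fun_prop)))
        (integrableOn_angleBox (by fun_prop))
        (fun k => ae_of_all _ fun θ => ?_) (ae_of_all _ fun θ => ?_)
      · rw [norm_mul, norm_pow, Real.norm_of_nonneg (densitySO_nonneg N θ)]
        exact mul_le_mul_of_nonneg_right
          (pow_le_pow_left₀ (norm_nonneg _) (hbound k _ (hcos θ)) n) (densitySO_nonneg N θ)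
      · exact ((hpoint _ (hcos θ)).pow n).mul_const _
    refine tendsto_nhds_unique hgroup ?_
    simpa only [integral_eval_traceSum] using hangle

end LinearStatistics

section LogDerivative

variable {N : ℕ} {s : ℝ}

theorem eigenFactor_pos (hs0 : 0 < s) (hs1 : s < 1) {y : ℝ} (hy : |y| ≤ 2) :
    0 < 1 + s ^ 2 - s * y := by
  nlinarith [(abs_le.mp hy).2, sq_pos_of_pos (sub_pos.mpr hs1)]

theorem one_sub_mul_neg_logDeriv_charPoly (hs0 : 0 < s) (hs1 : s < 1) {X : SOodd N}
    {y : Fin N → ℝ} (hy : ∀ j, |y j| ≤ 2)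
    (hX : ∀ s, charPoly X s = (1 - s) * ∏ j, (1 + s ^ 2 - s * y j)) :
    (1 - s) * -(logDeriv (charPoly X) s) =
      1 + ∑ j, (s - 1) * ((2 * s - y j) / (1 + s ^ 2 - s * y j)) := by
  have hpos : ∀ j ∈ Finset.univ, 1 + s ^ 2 - s * y j ≠ 0 := fun j _ =>
    (eigenFactor_pos hs0 hs1 (hy j)).ne'
  have hs : 1 - s ≠ 0 := (sub_pos.mpr hs1).ne'
  have hd : ∀ j, HasDerivAt (fun s : ℝ => 1 + s ^ 2 - s * y j) (2 * s - y j) s := fun j =>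
    ((((hasDerivAt_id s).pow 2).const_add 1).sub ((hasDerivAt_id s).mul_const (y j))).congr_deriv
      (by simp)
  have hl : HasDerivAt (fun s : ℝ => 1 - s) (-1) s := (hasDerivAt_id s).const_sub 1
  rw [funext hX, logDeriv_mul _ hs (Finset.prod_ne_zero_iff.mpr hpos) hl.differentiableAt
    (DifferentiableAt.fun_finsetProd fun j _ => (hd j).differentiableAt),
    logDeriv_prod hpos (fun j _ => (hd j).differentiableAt), logDeriv_apply, hl.deriv]
  simp only [logDeriv_apply, fun j => (hd j).deriv]
  rw [← Finset.mul_sum]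
  field_simp
  ring

theorem le_sum_eigenTerm (hs0 : 0 < s) (hs1 : s < 1)
    (hsN : 2 * (1 - s) * N / (s + 1) ≤ 1 / 2) {y : Fin N → ℝ} (hy : ∀ j, |y j| ≤ 2) :
    -(1 / 2) ≤ ∑ j, (s - 1) * ((2 * s - y j) / (1 + s ^ 2 - s * y j)) := by
  have hterm : ∀ j ∈ Finset.univ,
      -(2 * (1 - s) / (s + 1)) ≤ (s - 1) * ((2 * s - y j) / (1 + s ^ 2 - s * y j)) := by
    intro j _
    have h1 : (2 * s - y j) / (1 + s ^ 2 - s * y j) ≤ 2 / (s + 1) := by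
      rw [div_le_div_iff₀ (eigenFactor_pos hs0 hs1 (hy j)) (by linarith)]
      nlinarith [(abs_le.mp (hy j)).1]
    have h2 := mul_le_mul_of_nonneg_left h1 (sub_pos.mpr hs1).le
    have h3 : (1 - s) * (2 / (s + 1)) = 2 * (1 - s) / (s + 1) := by ring
    linarith
  have h := Finset.sum_le_sum hterm
  rw [Finset.sum_const, Finset.card_univ, Fintype.card_fin, nsmul_eq_mul] at h
  have h3 : (N : ℝ) * -(2 * (1 - s) / (s + 1)) = -(2 * (1 - s) * N / (s + 1)) := by ring
  linarith

end LogDerivative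

/-- Polynomial approximation of the `K`-th moment of the (negated) logarithmic derivative
of characteristic polynomials over `SO(2N+1)` by the quantities `h(n, s, N)`. -/
theorem moment_approx_by_hFun
    (K : ℝ) (hK : 0 < K) (N : ℕ) (s : ℝ) (hs0 : 0 < s) (hs1 : s < 1)
    (hsN : 2 * (1 - s) * N / (s + 1) ≤ 1 / 2)
    (m : ℕ) (hmodd : Odd m) (hKm : ⌊K⌋ ≤ (m : ℤ))
    (μ : Measure (SOodd N)) (hμHaar : μ.IsHaarMeasure) (hμProb : IsProbabilityMeasure μ) :
    (∀ X : SOodd N, 0 < -(logDeriv (charPoly X) s)) ∧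
    |(1 - s) ^ K * (∫ X, (-(logDeriv (charPoly X) s)) ^ K ∂μ) -
        ∑ n ∈ Finset.range (m + 1), genBinom K n * hFun n s N| ≤
      |genBinom K (m + 1)| * 2 ^ ((m : ℝ) + 1 - K) * hFun (m + 1) s N := by
  have hs : 0 < 1 - s := sub_pos.mpr hs1
  set W : SOodd N → ℝ := fun X => (1 - s) * -(logDeriv (charPoly X) s) - 1 with hWdef
  have hW : ∀ X, ∃ y : Fin N → ℝ, (∀ j, |y j| ≤ 2) ∧ (∀ l, traceSum X l = ∑ j, y j ^ l) ∧
      W X = ∑ j, (s - 1) * ((2 * s - y j) / (1 + s ^ 2 - s * y j)) := fun X => by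
    obtain ⟨y, hy2, hX, hy⟩ := exists_traceSum_eq X
    refine ⟨y, hy2, hy, ?_⟩
    simp only [hWdef]
    rw [one_sub_mul_neg_logDeriv_charPoly hs0 hs1 hy2 hX, add_sub_cancel_left]
  have hWge : ∀ X, -(1 / 2) ≤ W X := fun X => by
    obtain ⟨y, hy2, -, hWy⟩ := hW X
    rw [hWy]
    exact le_sum_eigenTerm hs0 hs1 hsN hy2
  have hpos : ∀ X : SOodd N, 0 < -(logDeriv (charPoly X) s) := fun X => by
    have h := hWge X
    simp only [hWdef] at h
    exact pos_of_mul_pos_right (by linarith : 0 < (1 - s) * -(logDeriv (charPoly X) s)) hs.le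
  refine ⟨hpos, ?_⟩
  obtain ⟨hWc, hWint⟩ := integral_linearStatistic_pow (μ := μ)
    (ψ := fun y => (s - 1) * ((2 * s - y) / (1 + s ^ 2 - s * y)))
    (ContinuousOn.mul continuousOn_const (ContinuousOn.div (by fun_prop) (by fun_prop)
      fun y hy => (eigenFactor_pos hs0 hs1 (abs_le.mpr hy)).ne')) hW
  have hmom : ∀ n, ∫ X, W X ^ n ∂μ = hFun n s N := fun n => by
    rw [hWint, hFun]
    simp only [← Finset.mul_sum, mul_left_comm s 2, mul_assoc]
  have hlhs : (1 - s) ^ K * ∫ X, (-(logDeriv (charPoly X) s)) ^ K ∂μ =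
      ∫ X, (1 + W X) ^ K ∂μ := by
    rw [← integral_const_mul]
    refine integral_congr_ae (ae_of_all _ fun X => ?_)
    simp only [hWdef, add_sub_cancel]
    rw [Real.mul_rpow hs.le (hpos X).le]
  have hKc : Continuous fun X => (1 + W X) ^ K :=
    (continuous_const.add hWc).rpow_const fun X => Or.inr hK.le
  have hsumc : Continuous fun X => ∑ n ∈ Finset.range (m + 1), genBinom K n * W X ^ n := by
    fun_prop
  have hsum : ∑ n ∈ Finset.range (m + 1), genBinom K n * hFun n s N =
      ∫ X, ∑ n ∈ Finset.range (m + 1), genBinom K n * W X ^ n ∂μ := by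
    rw [integral_finsetSum _ fun n _ => integrable_of_continuous_SOodd (by fun_prop)]
    simp only [integral_const_mul, hmom]
  have hKle : K ≤ ((m + 1 : ℕ) : ℝ) := by
    have h1 := Int.lt_floor_add_one K
    have h2 : ((⌊K⌋ : ℤ) : ℝ) ≤ m := by exact_mod_cast hKm
    push_cast
    linarith
  rw [hlhs, hsum, ← integral_sub (integrable_of_continuous_SOodd hKc)
    (integrable_of_continuous_SOodd hsumc), ← hmom, ← integral_const_mul]
  refine (abs_integral_le_integral_abs).trans (integral_mono
    (integrable_of_continuous_SOodd (hKc.sub hsumc).abs)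
    (integrable_of_continuous_SOodd (continuous_const.mul (hWc.pow (m + 1)))) fun X => ?_)
  have h := abs_one_add_rpow_sub_sum_le (m + 1) K hKle (W X) (hWge X)
  rw [hmodd.add_one.pow_abs] at h
  push_cast at h
  exact h
end
end

section
/- There exists a constant C > 0 such that for every N ∈ ℕ and every θ ∈ [−π, π] with sin θ ≠ 0, |N/π − sin(2Nθ)/(2π sin θ)| ≤ C · N³ · sin²(θ/2). -/
open Real

theorem abs_sin_natCast_mul_le (n : ℕ) (x : ℝ) : |Real.sin (n * x)| ≤ n * |Real.sin x| := by
  induction n with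
  | zero => simp
  | succ n ih =>
    have h : Real.sin ((n + 1 : ℕ) * x) =
        Real.sin (n * x) * Real.cos x + Real.cos (n * x) * Real.sin x := by
      rw [← Real.sin_add]; push_cast; ring_nf
    calc |Real.sin ((n + 1 : ℕ) * x)|
        ≤ |Real.sin (n * x)| * |Real.cos x| + |Real.cos (n * x)| * |Real.sin x| := by
          rw [h, ← abs_mul, ← abs_mul]; exact abs_add_le _ _
      _ ≤ |Real.sin (n * x)| * 1 + 1 * |Real.sin x| := by
          gcongr <;> exact Real.abs_cos_le_one _
      _ ≤ (n + 1 : ℕ) * |Real.sin x| := by push_cast; linarith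

theorem sin_two_mul_natCast_mul (N : ℕ) (θ : ℝ) :
    Real.sin (2 * N * θ) =
      2 * Real.sin θ * (N - ∑ k ∈ Finset.range N, 2 * Real.sin ((2 * k + 1 : ℕ) * (θ / 2)) ^ 2) := by
  induction N with
  | zero => simp
  | succ n ih =>
    have hcos : 2 * Real.sin ((2 * n + 1 : ℕ) * (θ / 2)) ^ 2 =
        1 - Real.cos ((2 * n + 1) * θ) := by
      have h := Real.cos_two_mul' ((2 * n + 1 : ℕ) * (θ / 2))
      have h' := Real.sin_sq_add_cos_sq ((2 * n + 1 : ℕ) * (θ / 2))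
      rw [show 2 * (((2 * n + 1 : ℕ) : ℝ) * (θ / 2)) = (2 * n + 1) * θ by push_cast; ring] at h
      linarith
    have hstep : Real.sin (2 * (n + 1 : ℕ) * θ) =
        Real.sin (2 * n * θ) + 2 * Real.sin θ * Real.cos ((2 * n + 1) * θ) := by
      rw [show 2 * ((n + 1 : ℕ) : ℝ) * θ = (2 * n + 1) * θ + θ by push_cast; ring,
        show 2 * (n : ℝ) * θ = (2 * n + 1) * θ - θ by ring, Real.sin_add, Real.sin_sub]
      ring
    rw [hstep, ih, Finset.sum_range_succ, hcos]
    push_cast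
    ring

/-- The one-point correlation function `R₁(θ) = N/π - sin(2Nθ)/(2π sin θ)` of `SO(2N+1)` is
bounded by a constant multiple of `N³ sin²(θ/2)`, uniformly in `N` and `θ ∈ [-π, π]`. -/
theorem onePoint_correlation_bound :
    ∃ C : ℝ, 0 < C ∧ ∀ (N : ℕ) (θ : ℝ), θ ∈ Set.Icc (-π) π → Real.sin θ ≠ 0 →
      |(N : ℝ) / π - Real.sin (2 * N * θ) / (2 * π * Real.sin θ)| ≤
        C * (N : ℝ) ^ 3 * Real.sin (θ / 2) ^ 2 := by
  refine ⟨8 / π, by positivity, fun N θ _ hθ => ?_⟩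
  have heq : (N : ℝ) / π - Real.sin (2 * N * θ) / (2 * π * Real.sin θ) =
      (∑ k ∈ Finset.range N, 2 * Real.sin ((2 * k + 1 : ℕ) * (θ / 2)) ^ 2) / π := by
    rw [sin_two_mul_natCast_mul]
    generalize ∑ k ∈ Finset.range N, 2 * Real.sin ((2 * k + 1 : ℕ) * (θ / 2)) ^ 2 = S
    field_simp
    ring
  rw [heq,
    abs_of_nonneg (div_nonneg (Finset.sum_nonneg fun k _ => by positivity) Real.pi_pos.le)]
  have hterm : ∀ k ∈ Finset.range N, 2 * Real.sin ((2 * k + 1 : ℕ) * (θ / 2)) ^ 2 ≤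
      8 * (N : ℝ) ^ 2 * Real.sin (θ / 2) ^ 2 := by
    intro k hk
    have hkN : ((2 * k + 1 : ℕ) : ℝ) ≤ 2 * N := by
      have := Finset.mem_range.mp hk
      exact_mod_cast (by omega : 2 * k + 1 ≤ 2 * N)
    have hsin : |Real.sin ((2 * k + 1 : ℕ) * (θ / 2))| ≤ 2 * N * |Real.sin (θ / 2)| :=
      (abs_sin_natCast_mul_le _ _).trans (by gcongr)
    have hsq := pow_le_pow_left₀ (abs_nonneg _) hsin 2
    rw [mul_pow, sq_abs, sq_abs] at hsq
    linarith
  have hsum := Finset.sum_le_card_nsmul _ _ _ hterm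
  rw [Finset.card_range, nsmul_eq_mul] at hsum
  calc _ ≤ (N * (8 * (N : ℝ) ^ 2 * Real.sin (θ / 2) ^ 2)) / π := by gcongr
    _ = 8 / π * (N : ℝ) ^ 3 * Real.sin (θ / 2) ^ 2 := by ring
end
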